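/- arXiv:1902.09019 — 3 statements merged into one kernel-verified Lean document; each statement's English description precedes it below -/
import Mathlib

section
/- Let d ≥ 2 and 1 ≤ k ≤ d−1. For every ε > 0 there exists a constant C = C(d,k,ε) such that for every R > 1, every X₀ ∈ ℝ^d, and every (k+1)-dimensional linear subspace W ⊆ ℝ^d, the number of points of ℤ^d in the embedded k-sphere R·S^k(X₀) = {x ∈ X₀ + W : |x − X₀| = R} is at most C·R^{k−1+ε}. The constant is independent of the embedding W, the center X₀, and the radius R. -/
theorem div_bound (δ : ℝ) (hδ : 0 < δ) : ∃ C : ℝ, 0 < C ∧ ∀ n : ℕ, n ≠ 0 →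
    (n.divisors.card : ℝ) ≤ C * (n : ℝ) ^ δ := by
  obtain ⟨M, hM⟩ := exists_nat_gt ((2:ℝ) ^ (1/δ))
  set K : ℝ := max 1 (1 / (δ * Real.log 2)) with hK
  have hl : 0 < Real.log 2 := Real.log_pos (by norm_num)
  have hK1 : 1 ≤ K := le_max_left _ _
  have hK2 : 1 ≤ K * (δ * Real.log 2) := by
    have : 1 / (δ * Real.log 2) ≤ K := le_max_right _ _
    rwa [div_le_iff₀ (by positivity)] at this
  refine ⟨K ^ M, by positivity, fun n hn => ?_⟩
  rw [Nat.card_divisors hn]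
  have h1 : (n : ℝ) ^ δ = ∏ p ∈ n.primeFactors, ((p : ℝ) ^ (n.factorization p)) ^ δ := by
    conv_lhs => rw [← Nat.prod_factorization_pow_eq_self hn]
    rw [Finsupp.prod, Nat.support_factorization]
    push_cast
    rw [Real.finsetProd_rpow]
    intro i _; positivity
  have h2 : ∀ p ∈ n.primeFactors, ((n.factorization p : ℝ) + 1) ≤
      (if p < M then K else 1) * ((p : ℝ) ^ (n.factorization p)) ^ δ := by
    intro p hp
    have hp2 : (2:ℝ) ≤ p := by exact_mod_cast (Nat.prime_of_mem_primeFactors hp).two_le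
    set a := n.factorization p
    have e1 : ((p : ℝ) ^ a) ^ δ = ((p:ℝ) ^ δ) ^ a := by
      rw [← Real.rpow_natCast, ← Real.rpow_natCast, ← Real.rpow_mul (by positivity), ← Real.rpow_mul (by positivity), mul_comm]
    split_ifs with h
    · have : 1 + δ * Real.log 2 * a ≤ ((p : ℝ) ^ a) ^ δ := by
        calc 1 + δ * Real.log 2 * a ≤ Real.exp (δ * Real.log 2 * a) := by
              linarith [Real.add_one_le_exp (δ * Real.log 2 * a)]
          _ = ((2:ℝ)^a)^δ := by
              rw [← Real.rpow_natCast, ← Real.rpow_mul (by positivity), Real.rpow_def_of_pos (by norm_num)]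
              ring_nf
          _ ≤ _ := by gcongr
      have ha : (0:ℝ) ≤ a := by positivity
      calc (a:ℝ) + 1 ≤ K * (1 + δ * Real.log 2 * a) := by nlinarith
        _ ≤ _ := by gcongr
    · rw [one_mul, e1]
      have hp3 : (2:ℝ) ≤ (p:ℝ)^δ := by
        have : (2:ℝ) ^ (1/δ) ≤ p := hM.le.trans (by exact_mod_cast not_lt.mp h)
        calc (2:ℝ) = ((2:ℝ) ^ (1/δ))^δ := by
              rw [← Real.rpow_mul (by norm_num), one_div_mul_cancel hδ.ne', Real.rpow_one]
          _ ≤ _ := by gcongr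
      calc (a:ℝ) + 1 ≤ 2 ^ a := by exact_mod_cast Nat.lt_two_pow_self
        _ ≤ _ := by gcongr
  push_cast
  calc _ ≤ ∏ p ∈ n.primeFactors, ((if p < M then K else 1) * ((p : ℝ) ^ (n.factorization p)) ^ δ) :=
        Finset.prod_le_prod (fun _ _ => by positivity) h2
    _ = (∏ p ∈ n.primeFactors, (if p < M then K else 1)) * (n:ℝ)^δ := by
        rw [Finset.prod_mul_distrib, h1]
    _ ≤ _ := by
        gcongr
        rw [← Finset.prod_filter, Finset.prod_const]
        apply pow_le_pow_right₀ hK1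
        calc _ ≤ (Finset.range M).card := Finset.card_le_card (by
              intro x hx; simp at hx; simp [hx.2])
          _ = M := by simp

theorem prim_count (D N : ℤ) (hD : 0 < D) (hN : 0 < N) (T : Finset (ℤ × ℤ))
    (hT : ∀ p ∈ T, p.1 ^ 2 + D * p.2 ^ 2 = N) (hc : ∀ p ∈ T, IsCoprime p.1 p.2) :
    T.card ≤ 10 * N.natAbs.divisors.card := by
  classical
  rcases T.eq_empty_or_nonempty with rfl | ⟨⟨X1, Y1⟩, h1⟩
  · simp
  have hcop : ∀ p ∈ T, IsCoprime p.2 N := by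
    intro p hp
    rw [← hT p hp]
    have := (hc p hp).symm.pow_right (n := 2)
    have h2 := this.add_mul_left_right (D * p.2)
    rwa [show p.1^2 + D * p.2^2 = p.1^2 + p.2 * (D * p.2) by ring]
  have hY1 := hcop _ h1
  have e1 := hT _ h1
  simp only at hY1 e1
  set f : ℤ × ℤ → ℕ := fun p => Int.gcd (X1 * p.2 - p.1 * Y1) N with hf
  have hfd : (T.image f) ⊆ N.natAbs.divisors := by
    intro g hg
    obtain ⟨p, hp, rfl⟩ := Finset.mem_image.1 hg
    rw [Nat.mem_divisors]
    refine ⟨?_, by omega⟩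
    exact Int.natCast_dvd.1 (Int.gcd_dvd_right _ _)
  refine (Finset.card_le_mul_card_image (f := f) T 10 ?_).trans (Nat.mul_le_mul_left _ (Finset.card_le_card hfd))
  intro g hg
  obtain ⟨⟨X2, Y2⟩, h2, hg2⟩ := Finset.mem_image.1 hg
  have hY2 := hcop _ h2
  have e2 := hT _ h2
  simp only at hY2 e2
  have hgN : (g:ℤ) ∣ N := hg2 ▸ Int.gcd_dvd_right _ _
  obtain ⟨g', hg'⟩ := hgN
  have hg0 : (g:ℤ) ≠ 0 := by rintro h; rw [h] at hg'; omega
  have key : ∀ p ∈ T, f p = g → (g:ℤ) ∣ X1 * p.2 - p.1 * Y1 ∧ g' ∣ X1 * p.2 + p.1 * Y1 := by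
    intro p hp hfp
    have hd : (g:ℤ) ∣ X1 * p.2 - p.1 * Y1 := hfp ▸ Int.gcd_dvd_left _ _
    refine ⟨hd, ?_⟩
    obtain ⟨u, hu⟩ := hd
    have hb := Int.gcd_eq_gcd_ab (X1 * p.2 - p.1 * Y1) N
    have hfp' : Int.gcd (X1 * p.2 - p.1 * Y1) N = g := hfp
    rw [hfp'] at hb
    have hcu : IsCoprime g' u := by
      refine ⟨Int.gcdB (X1 * p.2 - p.1 * Y1) N, Int.gcdA (X1 * p.2 - p.1 * Y1) N, ?_⟩
      apply mul_left_cancel₀ hg0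
      generalize Int.gcdB (X1 * p.2 - p.1 * Y1) N = β at *
      generalize Int.gcdA (X1 * p.2 - p.1 * Y1) N = α at *
      rw [hu] at hb
      linear_combination -hb - β * hg'
    apply hcu.dvd_of_dvd_mul_left
    refine ⟨p.2^2 - Y1^2, ?_⟩
    apply mul_left_cancel₀ hg0
    have ep := hT p hp
    linear_combination (-(X1 * p.2 + p.1 * Y1)) * hu + (p.2^2 - Y1^2) * hg' + p.2^2 * e1 - Y1^2 * ep
  obtain ⟨k1, k2⟩ := key _ h2 hg2
  simp only at k1 k2
  set h : ℤ := (Int.gcd g g' : ℤ) with hh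
  have hhg : h ∣ g := Int.gcd_dvd_left _ _
  have hhg' : h ∣ g' := Int.gcd_dvd_right _ _
  have hpos : 0 < h := by
    have : h ≠ 0 := fun hz => hg0 (by rw [hz] at hhg; exact zero_dvd_iff.1 hhg)
    have : 0 ≤ h := by positivity
    omega
  have hh2N : h^2 ∣ N := by rw [hg', sq]; exact mul_dvd_mul hhg hhg'
  have hhN : h ∣ N := (Dvd.intro_left _ (by ring : h * h = h^2)).trans hh2N
  have h2X : h ∣ 2 * X1 := by
    have : h ∣ (2 * X1) * Y2 := by
      have := dvd_add (hhg.trans k1) (hhg'.trans k2)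
      rwa [show 2 * X1 * Y2 = (X1 * Y2 - X2 * Y1) + (X1 * Y2 + X2 * Y1) by ring]
    exact (hY2.symm.of_isCoprime_of_dvd_left hhN).dvd_of_dvd_mul_right this
  have h4D : h^2 ≤ 4 * D := by
    apply Int.le_of_dvd (by omega)
    have i1 : h^2 ∣ (2*X1)^2 := pow_dvd_pow_of_dvd h2X 2
    have i2 : h^2 ∣ (4 * D) * Y1^2 := by
      have := dvd_sub (Dvd.dvd.mul_left hh2N 4) i1
      rwa [show 4 * D * Y1^2 = 4 * N - (2 * X1)^2 by linear_combination 4 * e1]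
    have : IsCoprime (h^2) (Y1^2) := (hY1.symm.of_isCoprime_of_dvd_left hh2N).pow_right
    exact this.dvd_of_dvd_mul_right i2
  have hδ : ∀ p ∈ T, f p = g → ∃ m : ℤ, h * (X2 * p.2 - p.1 * Y2) = m * N := by
    intro p hp hfp
    obtain ⟨l1, l2⟩ := key p hp hfp
    have j1 : (g:ℤ) ∣ X2 * p.2 - p.1 * Y2 := by
      have : (g:ℤ) ∣ (X2 * p.2 - p.1 * Y2) * Y1 := by
        have := dvd_sub (Dvd.dvd.mul_left l1 Y2) (Dvd.dvd.mul_left k1 p.2)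
        rwa [show (X2 * p.2 - p.1 * Y2) * Y1 = Y2 * (X1 * p.2 - p.1 * Y1) - p.2 * (X1 * Y2 - X2 * Y1) by ring]
      exact (hY1.symm.of_isCoprime_of_dvd_left ⟨g', hg'⟩).dvd_of_dvd_mul_right this
    have j2 : g' ∣ X2 * p.2 - p.1 * Y2 := by
      have : g' ∣ (X2 * p.2 - p.1 * Y2) * Y1 := by
        have := dvd_sub (Dvd.dvd.mul_left k2 p.2) (Dvd.dvd.mul_left l2 Y2)
        rwa [show (X2 * p.2 - p.1 * Y2) * Y1 = p.2 * (X1 * Y2 + X2 * Y1) - Y2 * (X1 * p.2 + p.1 * Y1) by ring]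
      exact (hY1.symm.of_isCoprime_of_dvd_left ⟨g, by rw [hg']; ring⟩).dvd_of_dvd_mul_right this
    obtain ⟨r, hr⟩ := j1
    obtain ⟨r', hr'⟩ := j2
    have hb := Int.gcd_eq_gcd_ab g g'
    refine ⟨Int.gcdA g g' * r' + Int.gcdB g g' * r, ?_⟩
    rw [hh, hb, hg', add_mul]
    generalize Int.gcdA g g' = α
    generalize Int.gcdB g g' = β
    linear_combination g * α * hr' + g' * β * hr
  have hcode : (T.filter (fun p => f p = g)).card ≤
      ((Finset.Icc (-2:ℤ) 2) ×ˢ (Finset.univ : Finset Bool)).card := by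
    apply Finset.card_le_card_of_injOn
      (fun p => (h * (X2 * p.2 - p.1 * Y2) / N, decide (0 ≤ X2 * p.1 + D * Y2 * p.2)))
    · intro p hp
      rw [Finset.mem_coe, Finset.mem_filter] at hp
      obtain ⟨m, hm⟩ := hδ p hp.1 hp.2
      have ep := hT p hp.1
      simp only [Finset.coe_product, Finset.coe_univ, Set.mem_prod, Set.mem_univ, and_true, Finset.coe_Icc, Set.mem_Icc]
      rw [hm, Int.mul_ediv_cancel _ hN.ne']
      have q1 : (X2 * p.1 + D * Y2 * p.2)^2 + D * (X2 * p.2 - p.1 * Y2)^2 = N^2 := by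
        rw [sq N]; nth_rewrite 1 [← e2]; rw [← ep]; ring
      have q2 : m^2 * N^2 ≤ 4 * N^2 := by
        have : m^2 * N^2 = h^2 * (X2 * p.2 - p.1 * Y2)^2 := by
          rw [← mul_pow, ← hm]; ring
        rw [this]
        nlinarith [sq_nonneg (X2 * p.1 + D * Y2 * p.2), sq_nonneg (X2 * p.2 - p.1 * Y2),
          mul_le_mul_of_nonneg_right h4D (sq_nonneg (X2 * p.2 - p.1 * Y2))]
      have q3 : m^2 ≤ 4 := le_of_mul_le_mul_right q2 (by positivity)
      constructor <;> nlinarith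
    · intro p hp q hq hpq
      rw [Finset.mem_coe, Finset.mem_filter] at hp hq
      obtain ⟨m, hm⟩ := hδ p hp.1 hp.2
      obtain ⟨m', hm'⟩ := hδ q hq.1 hq.2
      have ep := hT p hp.1
      have eq := hT q hq.1
      simp only [Prod.mk.injEq] at hpq
      rw [hm, hm', Int.mul_ediv_cancel _ hN.ne', Int.mul_ediv_cancel _ hN.ne'] at hpq
      obtain ⟨rfl, hs⟩ := hpq
      have hdd : X2 * p.2 - p.1 * Y2 = X2 * q.2 - q.1 * Y2 :=
        mul_left_cancel₀ hpos.ne' (hm.trans hm'.symm)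
      have q1 : (X2 * p.1 + D * Y2 * p.2)^2 + D * (X2 * p.2 - p.1 * Y2)^2 = N^2 := by
        rw [sq N]; nth_rewrite 1 [← e2]; rw [← ep]; ring
      have q2 : (X2 * q.1 + D * Y2 * q.2)^2 + D * (X2 * q.2 - q.1 * Y2)^2 = N^2 := by
        rw [sq N]; nth_rewrite 1 [← e2]; rw [← eq]; ring
      have hs' : (0 ≤ X2 * p.1 + D * Y2 * p.2) ↔ (0 ≤ X2 * q.1 + D * Y2 * q.2) := by
        simpa using hs
      have hee : X2 * p.1 + D * Y2 * p.2 = X2 * q.1 + D * Y2 * q.2 := by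
        rw [hdd] at q1
        have : (X2 * p.1 + D * Y2 * p.2)^2 = (X2 * q.1 + D * Y2 * q.2)^2 := by linarith
        rcases sq_eq_sq_iff_eq_or_eq_neg.1 this with h | h
        · exact h
        · omega
      have : N * p.1 = N * q.1 := by
        linear_combination X2 * hee - D * Y2 * hdd - (p.1 - q.1) * e2
      have h2 : N * p.2 = N * q.2 := by
        linear_combination Y2 * hee + X2 * hdd - (p.2 - q.2) * e2
      exact Prod.ext (mul_left_cancel₀ hN.ne' this) (mul_left_cancel₀ hN.ne' h2)
  simpa using hcode

theorem full_count (D N : ℤ) (hD : 0 < D) (hN : 0 < N) (T : Finset (ℤ × ℤ))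
    (hT : ∀ p ∈ T, p.1 ^ 2 + D * p.2 ^ 2 = N) :
    T.card ≤ 10 * N.natAbs.divisors.card * N.natAbs.divisors.card := by
  classical
  set f : ℤ × ℤ → ℕ := fun p => Int.gcd p.1 p.2 with hf
  have hsq : ∀ p ∈ T, ((f p : ℤ))^2 ∣ N := by
    intro p hp
    rw [← hT p hp]
    exact dvd_add (pow_dvd_pow_of_dvd (Int.gcd_dvd_left _ _) 2)
      ((pow_dvd_pow_of_dvd (Int.gcd_dvd_right _ _) 2).mul_left _)
  have hfd : (T.image f) ⊆ N.natAbs.divisors := by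
    intro g hg
    obtain ⟨p, hp, rfl⟩ := Finset.mem_image.1 hg
    rw [Nat.mem_divisors]
    refine ⟨Int.natCast_dvd.1 ((dvd_pow_self _ two_ne_zero).trans (hsq p hp)), by omega⟩
  refine (Finset.card_le_mul_card_image (f := f) T (10 * N.natAbs.divisors.card) ?_).trans (Nat.mul_le_mul_left _ (Finset.card_le_card hfd))
  intro g hg
  obtain ⟨p0, hp0, hpg⟩ := Finset.mem_image.1 hg
  obtain ⟨N', hN'⟩ := hsq p0 hp0
  rw [hpg] at hN'
  have hg0 : (g:ℤ) ≠ 0 := by rintro h; rw [h] at hN'; simp at hN'; omega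
  have hN'0 : 0 < N' := by
    have : 0 < (g:ℤ)^2 := by positivity
    by_contra hcon
    nlinarith
  have hr : ∀ p ∈ T.filter (fun p => f p = g), p.1 = g * (p.1 / g) ∧ p.2 = g * (p.2 / g) := by
    intro p hp
    rw [Finset.mem_filter] at hp
    have a1 : (g:ℤ) ∣ p.1 := hp.2 ▸ Int.gcd_dvd_left _ _
    have a2 : (g:ℤ) ∣ p.2 := hp.2 ▸ Int.gcd_dvd_right _ _
    exact ⟨(Int.mul_ediv_cancel' a1).symm, (Int.mul_ediv_cancel' a2).symm⟩
  have hinj : Set.InjOn (fun p : ℤ × ℤ => (p.1 / (g:ℤ), p.2 / (g:ℤ))) (T.filter (fun p => f p = g)) := by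
    intro p hp q hq hpq
    obtain ⟨a, b⟩ := hr p hp
    obtain ⟨c, d⟩ := hr q hq
    simp only [Prod.mk.injEq] at hpq
    exact Prod.ext (by rw [a, c, hpq.1]) (by rw [b, d, hpq.2])
  rw [← Finset.card_image_of_injOn hinj]
  refine (prim_count D N' hD hN'0 _ ?_ ?_).trans ?_
  · intro x hx
    obtain ⟨p, hp, rfl⟩ := Finset.mem_image.1 hx
    obtain ⟨a, b⟩ := hr p hp
    have := hT p (Finset.mem_filter.1 hp).1
    apply mul_left_cancel₀ (pow_ne_zero 2 hg0)
    simp only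
    generalize p.1 / (g:ℤ) = x at *
    generalize p.2 / (g:ℤ) = y at *
    rw [← hN', ← this, a, b]; ring
  · intro x hx
    obtain ⟨p, hp, rfl⟩ := Finset.mem_image.1 hx
    have hfp : Int.gcd p.1 p.2 = g := (Finset.mem_filter.1 hp).2
    obtain ⟨a, b⟩ := hr p hp
    have hb := Int.gcd_eq_gcd_ab p.1 p.2
    rw [hfp] at hb
    refine ⟨Int.gcdA p.1 p.2, Int.gcdB p.1 p.2, ?_⟩
    apply mul_left_cancel₀ hg0
    generalize Int.gcdA p.1 p.2 = α at *
    generalize Int.gcdB p.1 p.2 = β at *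
    simp only
    linear_combination -hb - α * a - β * b
  · refine Nat.mul_le_mul_left _ (Finset.card_le_card (Nat.divisors_subset_of_dvd (by omega) ?_))
    exact Int.natAbs_dvd_natAbs.2 ⟨(g:ℤ)^2, by rw [hN']; ring⟩

theorem span2 {d : ℕ} (V : Submodule ℝ (Fin d → ℝ)) (hV : Module.finrank ℝ V ≤ 2)
    (a b v : Fin d → ℝ) (ha : a ∈ V) (hb : b ∈ V) (hv : v ∈ V)
    (hD : (a ⬝ᵥ a) * (b ⬝ᵥ b) - (a ⬝ᵥ b) ^ 2 ≠ 0) :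
    ((a ⬝ᵥ a) * (b ⬝ᵥ b) - (a ⬝ᵥ b) ^ 2) • v =
      ((a ⬝ᵥ v) * (b ⬝ᵥ b) - (b ⬝ᵥ v) * (a ⬝ᵥ b)) • a
      + ((b ⬝ᵥ v) * (a ⬝ᵥ a) - (a ⬝ᵥ v) * (a ⬝ᵥ b)) • b := by
  rw [← sub_eq_zero]
  set w := ((a ⬝ᵥ a) * (b ⬝ᵥ b) - (a ⬝ᵥ b) ^ 2) • v -
      (((a ⬝ᵥ v) * (b ⬝ᵥ b) - (b ⬝ᵥ v) * (a ⬝ᵥ b)) • a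
      + ((b ⬝ᵥ v) * (a ⬝ᵥ a) - (a ⬝ᵥ v) * (a ⬝ᵥ b)) • b) with hw
  have hwV : w ∈ V := V.sub_mem (V.smul_mem _ hv) (V.add_mem (V.smul_mem _ ha) (V.smul_mem _ hb))
  have hba : b ⬝ᵥ a = a ⬝ᵥ b := dotProduct_comm _ _
  have haw : a ⬝ᵥ w = 0 := by
    rw [hw]; simp only [dotProduct_sub, dotProduct_add, dotProduct_smul, smul_eq_mul]; ring
  have hbw : b ⬝ᵥ w = 0 := by
    rw [hw]; simp only [dotProduct_sub, dotProduct_add, dotProduct_smul, smul_eq_mul, hba]; ring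
  by_contra hne
  have hww : w ⬝ᵥ w ≠ 0 := fun h => hne (dotProduct_self_eq_zero.1 h)
  have hli : LinearIndependent ℝ (![⟨a, ha⟩, ⟨b, hb⟩, ⟨w, hwV⟩] : Fin 3 → V) := by
    rw [Fintype.linearIndependent_iff]
    intro g hg
    have hg' := congrArg (Subtype.val) hg
    simp [Fin.sum_univ_three] at hg'
    have e1 := congrArg (fun x => a ⬝ᵥ x) hg'
    have e2 := congrArg (fun x => b ⬝ᵥ x) hg'
    have e3 := congrArg (fun x => w ⬝ᵥ x) hg'
    simp only [dotProduct_add, dotProduct_smul, smul_eq_mul, dotProduct_zero, haw, hbw, hba,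
      dotProduct_comm w a, dotProduct_comm w b, mul_zero, add_zero, zero_add] at e1 e2 e3
    have g2 : g 2 = 0 := by simpa [hww] using e3
    have g0 : g 0 = 0 := by
      have : g 0 * ((a ⬝ᵥ a) * (b ⬝ᵥ b) - (a ⬝ᵥ b) ^ 2) = 0 := by
        linear_combination (b ⬝ᵥ b) * e1 - (a ⬝ᵥ b) * e2
      simpa [hD] using this
    have g1 : g 1 = 0 := by
      have : g 1 * ((a ⬝ᵥ a) * (b ⬝ᵥ b) - (a ⬝ᵥ b) ^ 2) = 0 := by
        linear_combination (a ⬝ᵥ a) * e2 - (a ⬝ᵥ b) * e1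
      simpa [hD] using this
    intro i; fin_cases i <;> assumption
  have := hli.fintype_card_le_finrank
  simp at this
  omega

theorem cast_dot {d : ℕ} (a b : Fin d → ℤ) :
    (fun i => (a i : ℝ)) ⬝ᵥ (fun i => (b i : ℝ)) = ((a ⬝ᵥ b : ℤ) : ℝ) := by
  simp [dotProduct]

theorem circle_case (d : ℕ) (ε : ℝ) (hε : 0 < ε) :
    ∃ C : ℝ, 0 < C ∧ ∀ R : ℝ, 1 < R → ∀ (X : Fin d → ℝ) (V : Submodule ℝ (Fin d → ℝ)),
      Module.finrank ℝ V ≤ 2 → ∀ S : Finset (Fin d → ℤ),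
      (∀ m ∈ S, ∀ n ∈ S, (fun i => ((m i - n i : ℤ) : ℝ)) ∈ V) →
      (∀ n ∈ S, ∑ i, ((n i : ℝ) - X i) ^ 2 = R ^ 2) →
      (S.card : ℝ) ≤ C * R ^ ε := by
  classical
  obtain ⟨K, hK, hdiv⟩ := div_bound (ε/16) (by positivity)
  refine ⟨2 + 10 * K^2 * (256:ℝ)^(ε/8), by positivity, ?_⟩
  intro R hR X V hV S hSV hS
  have hRε : 1 ≤ R ^ ε := Real.one_le_rpow hR.le hε.le
  have hsmall : ∀ c : ℕ, c ≤ 2 → (c : ℝ) ≤ (2 + 10 * K^2 * (256:ℝ)^(ε/8)) * R ^ ε := by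
    intro c hc
    have : (c:ℝ) ≤ 2 := by exact_mod_cast hc
    have h0 : 0 ≤ 10 * K^2 * (256:ℝ)^(ε/8) := by positivity
    nlinarith
  by_cases hcard : S.card ≤ 2
  · exact hsmall _ hcard
  obtain ⟨P0, hP0, P1, hP1, hne⟩ := Finset.one_lt_card.1 (by omega : 1 < S.card)
  set Y : Fin d → ℝ := fun i => 2 * (X i - P0 i) with hY
  have hφ : ∀ n ∈ S, (((n - P0) ⬝ᵥ (n - P0) : ℤ) : ℝ) = Y ⬝ᵥ (fun i => ((n - P0) i : ℝ)) := by
    intro n hn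
    have h1 := hS n hn
    have h2 := hS P0 hP0
    rw [← h2, ← sub_eq_zero, ← Finset.sum_sub_distrib] at h1
    rw [← sub_eq_zero, ← h1, ← cast_dot, dotProduct, dotProduct, ← Finset.sum_sub_distrib]
    apply Finset.sum_congr rfl
    intro i _
    simp [hY]; ring
  have hdist : ∀ m ∈ S, ∀ n ∈ S, (((m - n) ⬝ᵥ (m - n) : ℤ) : ℝ) ≤ 4 * R^2 := by
    intro m hm n hn
    have h1 := hS n hn
    have h2 := hS m hm
    rw [show 4 * R^2 = 2 * R^2 + 2 * R^2 by ring]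
    nth_rewrite 1 [← h1]
    rw [← h2, ← cast_dot, dotProduct, Finset.mul_sum, Finset.mul_sum, ← Finset.sum_add_distrib]
    apply Finset.sum_le_sum
    intro i _
    simp
    nlinarith [sq_nonneg ((m i : ℝ) - X i + ((n i : ℝ) - X i))]
  set a := P1 - P0 with ha
  have haV : (fun i => (a i : ℝ)) ∈ V := hSV P1 hP1 P0 hP0
  have ha0 : a ≠ 0 := sub_ne_zero.2 hne.symm
  have hA0 : a ⬝ᵥ a ≠ 0 := fun h => ha0 (dotProduct_self_eq_zero.1 h)
  by_cases hcol : ∀ n ∈ S, (a ⬝ᵥ a) * ((n - P0) ⬝ᵥ (n - P0)) - (a ⬝ᵥ (n - P0))^2 ≤ 0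
  · refine absurd ?_ hcard
    refine (Finset.card_le_card (?_ : S ⊆ {P0, P1})).trans Finset.card_le_two
    intro n hn
    have h1 := hcol n hn
    have h2 := hφ n hn
    have h3 := hφ P1 hP1
    rw [← ha] at h3
    set v := n - P0 with hv
    have hA : 0 ≤ a ⬝ᵥ a := by
      rw [dotProduct]; exact Finset.sum_nonneg (fun i _ => mul_self_nonneg _)
    have hw : (a ⬝ᵥ a) • v - (a ⬝ᵥ v) • a = 0 := by
      rw [← dotProduct_self_eq_zero]
      apply le_antisymm
      · simp only [dotProduct_sub, sub_dotProduct, dotProduct_smul, smul_dotProduct, smul_eq_mul, dotProduct_comm v a]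
        nlinarith
      · rw [dotProduct]; exact Finset.sum_nonneg (fun i _ => mul_self_nonneg _)
    rw [sub_eq_zero] at hw
    have e1 : (a ⬝ᵥ a) * (v ⬝ᵥ v) = (a ⬝ᵥ v) * (a ⬝ᵥ v) := by
      have := congrArg (fun x => v ⬝ᵥ x) hw
      simpa only [dotProduct_smul, smul_eq_mul, dotProduct_comm v a] using this
    have e2 : ((a ⬝ᵥ a : ℤ) : ℝ) * ((v ⬝ᵥ v : ℤ):ℝ) = ((a ⬝ᵥ v : ℤ):ℝ) * ((a ⬝ᵥ a : ℤ):ℝ) := by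
      rw [h2]
      nth_rewrite 2 [h3]
      simp only [dotProduct, Finset.mul_sum]
      apply Finset.sum_congr rfl
      intro i _
      have := congrArg (fun x : Fin d → ℤ => ((x i : ℤ):ℝ)) hw
      simp only [Pi.smul_apply, smul_eq_mul, Int.cast_mul] at this
      simp only [dotProduct] at this
      linear_combination Y i * this
    have e3 : (a ⬝ᵥ a) * (v ⬝ᵥ v) = (a ⬝ᵥ v) * (a ⬝ᵥ a) := by exact_mod_cast e2
    have e4 : (a ⬝ᵥ v) * ((a ⬝ᵥ v) - (a ⬝ᵥ a)) = 0 := by linear_combination e3 - e1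
    rw [Finset.mem_insert, Finset.mem_singleton]
    rcases mul_eq_zero.1 e4 with h | h
    · left
      rw [h, zero_smul] at hw
      exact sub_eq_zero.1 ((smul_eq_zero.1 hw).resolve_left hA0)
    · right
      rw [sub_eq_zero.1 h] at hw
      have := smul_right_injective _ hA0 hw
      exact sub_left_injective this
  push Not at hcol
  obtain ⟨P2, hP2, hDpos⟩ := hcol
  set b := P2 - P0 with hb
  have hbV : (fun i => (b i : ℝ)) ∈ V := hSV P2 hP2 P0 hP0
  set A := a ⬝ᵥ a with hAdef
  set B := a ⬝ᵥ b with hBdef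
  set G := b ⬝ᵥ b with hGdef
  set D := A * G - B^2 with hDdef
  set N := A^2 * G * (A + G - 2 * B) with hNdef
  have hNeq : (A * (G - B))^2 + D * A^2 = N := by rw [hDdef, hNdef]; ring
  have hNpos : 0 < N := by
    rw [← hNeq]; have : 0 < A^2 := by positivity
    positivity
  have hab : (P1 - P2) ⬝ᵥ (P1 - P2) = A + G - 2 * B := by
    have : P1 - P2 = a - b := by rw [ha, hb]; abel
    rw [this]
    simp only [dotProduct_sub, sub_dotProduct, dotProduct_comm b a]
    ring
  have hexp : ∀ n ∈ S, D • (n - P0) = ((a ⬝ᵥ (n-P0)) * G - (b ⬝ᵥ (n-P0)) * B) • a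
      + ((b ⬝ᵥ (n-P0)) * A - (a ⬝ᵥ (n-P0)) * B) • b := by
    intro n hn
    have := span2 V hV _ _ _ haV hbV (hSV n hn P0 hP0) (by
      rw [cast_dot, cast_dot, cast_dot]
      exact_mod_cast hDpos.ne')
    change _ • (fun i => (((n - P0) i : ℤ) : ℝ)) = (((fun i => (a i : ℝ)) ⬝ᵥ (fun i => (((n - P0) i : ℤ) : ℝ))) * _ - ((fun i => (b i : ℝ)) ⬝ᵥ (fun i => (((n - P0) i : ℤ) : ℝ))) * _) • _ + (((fun i => (b i : ℝ)) ⬝ᵥ (fun i => (((n - P0) i : ℤ) : ℝ))) * _ - ((fun i => (a i : ℝ)) ⬝ᵥ (fun i => (((n - P0) i : ℤ) : ℝ))) * _) • _ at this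
    simp only [cast_dot] at this
    funext i
    have h := congrFun this i
    simp only [Pi.smul_apply, Pi.add_apply, smul_eq_mul] at h ⊢
    exact_mod_cast h
  have hid : ∀ n ∈ S, ((a ⬝ᵥ (n-P0)) * G - (b ⬝ᵥ (n-P0)) * B) * ((a ⬝ᵥ (n-P0)) - A)
      + ((b ⬝ᵥ (n-P0)) * A - (a ⬝ᵥ (n-P0)) * B) * ((b ⬝ᵥ (n-P0)) - G) = 0 := by
    intro n hn
    have h0 := hexp n hn
    have h1 := hφ n hn
    have h2 := hφ P1 hP1
    have h3 := hφ P2 hP2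
    rw [← ha, ← hAdef] at h2
    rw [← hb, ← hGdef] at h3
    set v := n - P0 with hv
    set p := a ⬝ᵥ v with hp
    set q := b ⬝ᵥ v with hq
    have e1 : D * (v ⬝ᵥ v) = (p * G - q * B) * p + (q * A - p * B) * q := by
      have := congrArg (fun x => v ⬝ᵥ x) h0
      simpa only [dotProduct_smul, dotProduct_add, smul_eq_mul, dotProduct_comm v a, dotProduct_comm v b] using this
    have e2 : (D:ℝ) * ((v ⬝ᵥ v : ℤ):ℝ) = ((p * G - q * B : ℤ):ℝ) * (A:ℝ) + ((q * A - p * B : ℤ):ℝ) * (G:ℝ) := by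
      generalize p * G - q * B = s at *
      generalize q * A - p * B = t at *
      rw [h1, h2, h3]
      rw [← smul_eq_mul, ← smul_eq_mul (t:ℝ), ← smul_eq_mul (s:ℝ), ← dotProduct_smul, ← dotProduct_smul, ← dotProduct_smul, ← dotProduct_add]
      congr 1
      funext i
      have h := congrFun h0 i
      simp only [Pi.smul_apply, Pi.add_apply, smul_eq_mul] at h ⊢
      exact_mod_cast h
    have e3 : D * (v ⬝ᵥ v) = (p * G - q * B) * A + (q * A - p * B) * G := by exact_mod_cast e2
    linear_combination e3 - e1
  set F : (Fin d → ℤ) → ℤ × ℤ := fun n =>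
    (2 * ((b ⬝ᵥ (n-P0)) * A - (a ⬝ᵥ (n-P0)) * B) - A * (G - B), 2 * (a ⬝ᵥ (n-P0)) - A) with hF
  have hFinj : Set.InjOn F S := by
    intro m hm n hn hmn
    simp only [hF, Prod.mk.injEq] at hmn
    have e1 := hexp m hm
    have e2 := hexp n hn
    have hp : a ⬝ᵥ (m - P0) = a ⬝ᵥ (n - P0) := by linarith [hmn.2]
    have hq : b ⬝ᵥ (m - P0) = b ⬝ᵥ (n - P0) := by
      have := hmn.1
      rw [hp] at this
      exact mul_right_cancel₀ hA0 (by linarith)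
    rw [hp, hq, ← e2] at e1
    exact sub_left_injective (smul_right_injective _ hDpos.ne' e1)
  have hcount := full_count D N hDpos hNpos (S.image F) (by
    intro x hx
    obtain ⟨n, hn, rfl⟩ := Finset.mem_image.1 hx
    have h := hid n hn
    simp only [hF]
    generalize a ⬝ᵥ (n - P0) = p at *
    generalize b ⬝ᵥ (n - P0) = q at *
    rw [← hNeq, hDdef]
    linear_combination 4 * A * h)
  rw [Finset.card_image_of_injOn hFinj] at hcount
  have hNR : (N : ℝ) ≤ 256 * R^8 := by
    have b1 := hdist P1 hP1 P0 hP0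
    have b2 := hdist P2 hP2 P0 hP0
    have b3 := hdist P1 hP1 P2 hP2
    rw [hab] at b3
    rw [← ha, ← hAdef] at b1
    rw [← hb, ← hGdef] at b2
    have n1 : 0 ≤ (A:ℝ) := by
      rw [hAdef, dotProduct]; exact_mod_cast Finset.sum_nonneg (fun i _ => mul_self_nonneg _)
    have n2 : 0 ≤ (G:ℝ) := by
      rw [hGdef, dotProduct]; exact_mod_cast Finset.sum_nonneg (fun i _ => mul_self_nonneg _)
    have n3 : 0 ≤ ((A + G - 2 * B : ℤ):ℝ) := by
      rw [← hab, dotProduct]; exact_mod_cast Finset.sum_nonneg (fun i _ => mul_self_nonneg _)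
    calc (N:ℝ) = (A:ℝ)^2 * G * ((A + G - 2 * B : ℤ):ℝ) := by rw [hNdef]; push_cast; ring
      _ ≤ (4 * R^2)^2 * (4*R^2) * (4*R^2) := by gcongr
      _ = _ := by ring
  have hd := hdiv N.natAbs (by omega)
  have hNabs : ((N.natAbs : ℕ) : ℝ) = (N:ℝ) := by
    have : ((N.natAbs : ℕ) : ℤ) = N := by omega
    rw [← Int.cast_natCast, this]
  rw [hNabs] at hd
  have hNp : (0:ℝ) < N := by exact_mod_cast hNpos
  have hfin : ((N:ℝ)^(ε/16))^2 ≤ (256:ℝ)^(ε/8) * R^ε := by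
    calc ((N:ℝ)^(ε/16))^2 = (N:ℝ)^(ε/8) := by
          rw [← Real.rpow_natCast, ← Real.rpow_mul hNp.le]; congr 1; push_cast; ring
      _ ≤ (256 * R^8)^(ε/8) := by gcongr
      _ = _ := by
          rw [Real.mul_rpow (by norm_num) (by positivity), ← Real.rpow_natCast R, ← Real.rpow_mul (by positivity)]
          congr 2; push_cast; ring
  calc (S.card : ℝ) ≤ 10 * N.natAbs.divisors.card * N.natAbs.divisors.card := by exact_mod_cast hcount
    _ ≤ 10 * (K * (N:ℝ)^(ε/16)) * (K * (N:ℝ)^(ε/16)) := by gcongr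
    _ = 10 * K^2 * ((N:ℝ)^(ε/16))^2 := by ring
    _ ≤ 10 * K^2 * ((256:ℝ)^(ε/8) * R^ε) := by gcongr
    _ ≤ _ := by nlinarith

theorem sphere_case (d : ℕ) (ε : ℝ) (hε : 0 < ε) (k : ℕ) :
    ∃ C : ℝ, 0 < C ∧ ∀ R : ℝ, 1 < R → ∀ (X : Fin d → ℝ) (V : Submodule ℝ (Fin d → ℝ)),
      Module.finrank ℝ V ≤ k + 2 → ∀ S : Finset (Fin d → ℤ),
      (∀ m ∈ S, ∀ n ∈ S, (fun i => ((m i - n i : ℤ) : ℝ)) ∈ V) →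
      (∀ n ∈ S, ∑ i, ((n i : ℝ) - X i) ^ 2 = R ^ 2) →
      (S.card : ℝ) ≤ C * R ^ ((k:ℝ) + ε) := by
  classical
  induction k with
  | zero => simpa using circle_case d ε hε
  | succ k ih =>
    obtain ⟨C, hC, ih⟩ := ih
    refine ⟨3 * C, by positivity, ?_⟩
    intro R hR X V hV S hSV hS
    have hpow : R ^ (((k+1:ℕ):ℝ) + ε) = R * R ^ ((k:ℝ) + ε) := by
      rw [← Real.rpow_one_add' (by positivity) (by positivity)]
      congr 1; push_cast; ring
    by_cases hbot : ∀ i, ∀ v ∈ V, v i = 0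
    · have hV0 : V = ⊥ := by
        rw [eq_bot_iff]; intro v hv
        rw [Submodule.mem_bot]; funext i; exact hbot i v hv
      have := ih R hR X V (by rw [hV0]; simp) S hSV hS
      refine this.trans ?_
      rw [hpow]
      have : 0 < C * R ^ ((k:ℝ)+ε) := by positivity
      nlinarith
    push Not at hbot
    obtain ⟨i, v0, hv0, hvi⟩ := hbot
    set V' : Submodule ℝ (Fin d → ℝ) := V ⊓ LinearMap.ker (LinearMap.proj i : (Fin d → ℝ) →ₗ[ℝ] ℝ) with hV'
    have hlt : V' < V := by
      refine lt_of_le_of_ne inf_le_left ?_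
      intro h
      rw [← h] at hv0
      exact hvi (by simpa using hv0.2)
    have hfr : Module.finrank ℝ V' ≤ k + 2 := by
      have := Submodule.finrank_lt_finrank_of_lt hlt
      omega
    have hfib : ∀ j ∈ S.image (fun n => n i), ((S.filter (fun n => n i = j)).card : ℝ) ≤ C * R ^ ((k:ℝ)+ε) := by
      intro j _
      apply ih R hR X V' hfr
      · intro m hm n hn
        rw [Finset.mem_filter] at hm hn
        refine ⟨hSV m hm.1 n hn.1, ?_⟩
        simp [hm.2, hn.2]
      · intro n hn
        exact hS n (Finset.mem_filter.1 hn).1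
    have himg : ((S.image (fun n => n i)).card : ℝ) ≤ 3 * R := by
      have hsub : S.image (fun n => n i) ⊆ Finset.Icc ⌈X i - R⌉ ⌊X i + R⌋ := by
        intro j hj
        obtain ⟨n, hn, rfl⟩ := Finset.mem_image.1 hj
        have h1 : ((n i : ℝ) - X i)^2 ≤ R^2 := by
          rw [← hS n hn]
          exact Finset.single_le_sum (f := fun i => ((n i : ℝ) - X i)^2) (fun _ _ => sq_nonneg _) (Finset.mem_univ i)
        have h2 := abs_le_of_sq_le_sq' h1 (by linarith)
        rw [Finset.mem_Icc, Int.ceil_le, Int.le_floor]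
        constructor <;> linarith [h2.1, h2.2]
      have h1 := Finset.card_le_card hsub
      rw [Int.card_Icc] at h1
      have h2 : ((⌊X i + R⌋ + 1 - ⌈X i - R⌉ : ℤ):ℝ) ≤ 3 * R := by
        push_cast
        linarith [Int.floor_le (X i + R), Int.le_ceil (X i - R)]
      rcases le_total 0 (⌊X i + R⌋ + 1 - ⌈X i - R⌉) with h | h
      · refine le_trans ?_ h2
        have : ((S.image (fun n => n i)).card : ℤ) ≤ (⌊X i + R⌋ + 1 - ⌈X i - R⌉) := by omega
        exact_mod_cast this
      · have : (S.image (fun n => n i)).card = 0 := by omega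
        rw [this]; push_cast; linarith
    have hsum : (S.card : ℝ) = ∑ j ∈ S.image (fun n => n i), ((S.filter (fun n => n i = j)).card : ℝ) := by
      exact_mod_cast Finset.card_eq_sum_card_image (fun n : Fin d → ℤ => n i) S
    rw [hsum, hpow]
    calc _ ≤ ∑ j ∈ S.image (fun n => n i), C * R ^ ((k:ℝ)+ε) := Finset.sum_le_sum hfib
      _ = ((S.image (fun n => n i)).card : ℝ) * (C * R ^ ((k:ℝ)+ε)) := by
          rw [Finset.sum_const, nsmul_eq_mul]
      _ ≤ (3 * R) * (C * R ^ ((k:ℝ)+ε)) := by gcongr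
      _ = _ := by ring

theorem stmt14 (d k : ℕ) (hd : 2 ≤ d) (hk1 : 1 ≤ k) (hk2 : k ≤ d - 1)
    (ε : ℝ) (hε : 0 < ε) :
    ∃ C : ℝ, 0 < C ∧
      ∀ (R : ℝ), 1 < R →
        ∀ (X₀ : Fin d → ℝ) (W : Submodule ℝ (Fin d → ℝ)),
          Module.finrank ℝ W = k + 1 →
            (Set.ncard {n : Fin d → ℤ |
                (fun i => (n i : ℝ) - X₀ i) ∈ W ∧
                (∑ i, ((n i : ℝ) - X₀ i) ^ 2) = R ^ 2} : ℝ)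
              ≤ C * R ^ ((k : ℝ) - 1 + ε) := by
  obtain ⟨j, rfl⟩ : ∃ j, k = j + 1 := ⟨k - 1, by omega⟩
  obtain ⟨C, hC, h⟩ := sphere_case d ε hε j
  refine ⟨C, hC, ?_⟩
  intro R hR X W hW
  have he : (((j + 1 : ℕ) : ℝ) - 1 + ε) = (j : ℝ) + ε := by push_cast; ring
  rw [he]
  by_cases hfin : {n : Fin d → ℤ | (fun i => (n i : ℝ) - X i) ∈ W ∧
                (∑ i, ((n i : ℝ) - X i) ^ 2) = R ^ 2}.Finite
  · rw [Set.ncard_eq_toFinset_card _ hfin]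
    apply h R hR X W (by omega)
    · intro m hm n hn
      rw [Set.Finite.mem_toFinset] at hm hn
      have := W.sub_mem hm.1 hn.1
      convert this using 1
      funext i
      simp
    · intro n hn
      rw [Set.Finite.mem_toFinset] at hn
      exact hn.2
  · rw [Set.Infinite.ncard hfin]
    push_cast
    positivity
end

section
/- For every ε > 0 and every V₀ > 0 there exists a constant C = C(ε, V₀) such that the following holds for every λ > 1: if E is a subset of the sphere {x ∈ ℝ³ : |x| = λ} such that the convex hull of E in ℝ³ has Lebesgue volume at most V₀, then the number of points of ℤ³ in E is at most C·λ^ε. -/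
open MeasureTheory

theorem divisor_bound (ε : ℝ) (hε : 0 < ε) :
    ∃ C : ℝ, 0 < C ∧ ∀ n : ℕ, n ≠ 0 → (n.divisors.card : ℝ) ≤ C * (n : ℝ) ^ ε := by
  obtain ⟨P, hP⟩ := exists_nat_ge ((2:ℝ) ^ (1/ε))
  have hl2 : 0 < Real.log 2 := Real.log_pos (by norm_num)
  set K : ℝ := max 1 (1 / (ε * Real.log 2)) with hK
  have hK1 : 1 ≤ K := le_max_left _ _
  have hK2 : 1 ≤ K * (ε * Real.log 2) := by
    have h : 1 / (ε * Real.log 2) ≤ K := le_max_right _ _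
    rwa [div_le_iff₀ (by positivity)] at h
  refine ⟨K ^ P, by positivity, fun n hn => ?_⟩
  have key : ∀ p : ℕ, p.Prime → ∀ k : ℕ,
      ((k : ℝ) + 1) ≤ (if p < P then K else 1) * (((p : ℝ) ^ k) ^ ε) := by
    intro p hp k
    have hp2 : (2:ℝ) ≤ p := by exact_mod_cast hp.two_le
    have hpe : ((p:ℝ)^k)^ε = ((p:ℝ)^ε)^k := by
      rw [← Real.rpow_natCast, ← Real.rpow_natCast, ← Real.rpow_mul (by positivity),
        ← Real.rpow_mul (by positivity), mul_comm]
    split_ifs with h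
    · have h1 : 1 + (k:ℝ) * (ε * Real.log 2) ≤ ((p:ℝ)^ε)^k := by
        have h2 : ((2:ℝ)^ε)^k ≤ ((p:ℝ)^ε)^k := by gcongr
        have h3 : ((2:ℝ)^ε)^k = Real.exp ((k:ℝ) * (ε * Real.log 2)) := by
          rw [Real.rpow_def_of_pos (by norm_num), ← Real.exp_nat_mul]
          ring_nf
        have h4 := Real.add_one_le_exp ((k:ℝ) * (ε * Real.log 2))
        linarith
      rw [hpe]
      have hk : (0:ℝ) ≤ k := by positivity
      calc (k:ℝ) + 1 ≤ K * (1 + (k:ℝ) * (ε * Real.log 2)) := by nlinarith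
        _ ≤ _ := by gcongr
    · rw [hpe, one_mul]
      have h1 : (2:ℝ) ≤ (p:ℝ)^ε := by
        have h2 : (2:ℝ)^(1/ε) ≤ p := hP.trans (by exact_mod_cast not_lt.mp h)
        calc (2:ℝ) = ((2:ℝ)^(1/ε))^ε := by
              rw [← Real.rpow_mul (by norm_num), one_div_mul_cancel hε.ne', Real.rpow_one]
          _ ≤ _ := by gcongr
      calc (k:ℝ) + 1 ≤ (2:ℝ)^k := by exact_mod_cast Nat.lt_two_pow_self
        _ ≤ _ := by gcongr
  have hne : (n:ℝ)^ε = ∏ p ∈ n.primeFactors, (((p:ℝ) ^ (n.factorization p)) ^ ε) := by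
    rw [Real.finsetProd_rpow _ _ (fun i _ => by positivity)]
    congr 1
    conv_lhs => rw [← Nat.prod_factorization_pow_eq_self hn]
    rw [Finsupp.prod, Nat.support_factorization]
    push_cast
    rfl
  rw [Nat.card_divisors hn, hne]
  push_cast
  calc (∏ p ∈ n.primeFactors, ((n.factorization p : ℝ) + 1))
      ≤ ∏ p ∈ n.primeFactors, ((if p < P then K else 1) * (((p:ℝ) ^ (n.factorization p)) ^ ε)) := by
        apply Finset.prod_le_prod
        · intros; positivity
        · intro p hp; exact key p (Nat.prime_of_mem_primeFactors hp) _
    _ = (∏ p ∈ n.primeFactors, (if p < P then K else 1)) * _ := Finset.prod_mul_distrib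
    _ ≤ _ := by
        gcongr
        rw [Finset.prod_ite, Finset.prod_const, Finset.prod_const_one, mul_one]
        apply pow_le_pow_right₀ hK1
        calc _ ≤ (Finset.range P).card := Finset.card_le_card (by
              intro x hx; simp at hx ⊢; exact hx.2)
          _ = P := Finset.card_range P

theorem prim_core (s M u1 v1 u2 v2 u3 v3 d : ℤ) (hs : Squarefree s) (hM : 0 < M)
    (h1 : u1^2 + s*v1^2 = M) (h2 : u2^2 + s*v2^2 = M) (h3 : u3^2 + s*v3^2 = M)
    (c1 : IsCoprime u1 v1) (c2 : IsCoprime u2 v2)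
    (hd2 : ((M.gcd (u1*v2-u2*v1) : ℕ) : ℤ) = d) (hd3 : ((M.gcd (u1*v3-u3*v1) : ℕ):ℤ) = d) :
    M ∣ 2 * (u2*v3-u3*v2) := by
  have cop : ∀ u v : ℤ, u^2 + s*v^2 = M → IsCoprime u v → IsCoprime v M := by
    intro u v h c
    rw [← h]
    have : IsCoprime v (u^2) := c.symm.pow_right
    have h9 := this.add_mul_left_right (s*v)
    rwa [show u^2 + s*v^2 = u^2 + v*(s*v) by ring]
  have cv1 := cop _ _ h1 c1
  have cv2 := cop _ _ h2 c2
  have hdM : d ∣ M := hd2 ▸ Int.gcd_dvd_left ..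
  have hd2' : d ∣ u1*v2-u2*v1 := hd2 ▸ Int.gcd_dvd_right ..
  have hd3' : d ∣ u1*v3-u3*v1 := hd3 ▸ Int.gcd_dvd_right ..
  obtain ⟨e, he⟩ := hdM
  have hd0 : d ≠ 0 := by rintro rfl; simp at he; omega
  have other : ∀ u v : ℤ, u^2+s*v^2 = M → ((M.gcd (u1*v-u*v1) : ℕ):ℤ) = d → e ∣ u1*v+u*v1 := by
    intro u v h hd
    have hz : d ∣ u1*v-u*v1 := hd ▸ Int.gcd_dvd_right ..
    obtain ⟨f, hf⟩ := hz
    have hg : IsCoprime e f := by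
      rw [Int.isCoprime_iff_gcd_eq_one]
      have : ((M.gcd (u1*v-u*v1) : ℕ):ℤ) = d.natAbs * (e.gcd f) := by
        rw [hf, he, Int.gcd_mul_left]; push_cast; rfl
      rw [hd] at this
      have hdn : (0:ℤ) ≤ d := by rw [← hd]; positivity
      rw [Int.natAbs_of_nonneg hdn] at this
      have h5 : d * ((e.gcd f : ℕ) : ℤ) = d * 1 := by linarith
      have := mul_left_cancel₀ hd0 h5
      exact_mod_cast this
    have h6 : d * e ∣ d * (f * (u1*v+u*v1)) := by
      rw [← he]
      refine ⟨v^2 - v1^2, ?_⟩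
      have : d * (f * (u1*v+u*v1)) = (u1*v-u*v1)*(u1*v+u*v1) := by rw [hf]; ring
      rw [this]
      linear_combination (v^2)*h1 - v1^2*h
    exact hg.dvd_of_dvd_mul_left ((mul_dvd_mul_iff_left hd0).mp h6)
  have e2 := other _ _ h2 hd2
  have e3 := other _ _ h3 hd3
  set X := u2*v3-u3*v2 with hX
  have hdX : d ∣ X := by
    have : d ∣ v1 * X := by
      have h := dvd_sub (hd3'.mul_left v2) (hd2'.mul_left v3)
      rwa [show v1 * X = v2*(u1*v3-u3*v1) - v3*(u1*v2-u2*v1) by rw [hX]; ring]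
    exact (cv1.of_isCoprime_of_dvd_right ⟨e, he⟩).symm.dvd_of_dvd_mul_left this
  have heX : e ∣ X := by
    have : e ∣ v1 * X := by
      have h := dvd_sub (e2.mul_left v3) (e3.mul_left v2)
      rwa [show v1 * X = v3*(u1*v2+u2*v1) - v2*(u1*v3+u3*v1) by rw [hX]; ring]
    exact (cv1.of_isCoprime_of_dvd_right ⟨d, by rw [he]; ring⟩).symm.dvd_of_dvd_mul_left this
  set h : ℤ := ((d.gcd e : ℕ) : ℤ) with hh
  have hhd : h ∣ d := Int.gcd_dvd_left ..
  have hhe : h ∣ e := Int.gcd_dvd_right ..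
  have hhM : h ∣ M := hhd.trans ⟨e, he⟩
  have hh2M : h^2 ∣ M := by rw [he, sq]; exact mul_dvd_mul hhd hhe
  have hu1 : h ∣ 2*u1 := by
    have : h ∣ v2 * (2*u1) := by
      have h9 := dvd_add (hhd.trans hd2') (hhe.trans e2)
      rwa [show v2 * (2*u1) = u1*v2-u2*v1 + (u1*v2+u2*v1) by ring]
    exact (cv2.of_isCoprime_of_dvd_right hhM).symm.dvd_of_dvd_mul_left this
  have h4s : h^2 ∣ 4*s := by
    have h7 : h^2 ∣ v1^2 * (4*s) := by
      have h8 := dvd_sub (hh2M.mul_left 4) (pow_dvd_pow_of_dvd hu1 2)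
      rwa [show v1^2 * (4*s) = 4*M - (2*u1)^2 by rw [← h1]; ring]
    exact ((cv1.of_isCoprime_of_dvd_right hhM).symm.pow (m := 2) (n := 2)).dvd_of_dvd_mul_left h7
  have hh2 : h ∣ 2 := by
    by_cases hpar : (2:ℤ) ∣ h
    · obtain ⟨g, hg⟩ := hpar
      rw [hg] at h4s ⊢
      have : g*g ∣ s := by
        have : 4 * (g*g) ∣ 4 * s := by convert h4s using 1; ring
        exact (mul_dvd_mul_iff_left (by norm_num)).mp this
      have := hs g this
      have h9 : g ∣ 1 := this.dvd
      exact mul_dvd_mul_left 2 h9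
    · have hc : IsCoprime h 2 := ((Int.prime_two.irreducible.coprime_iff_not_dvd).mpr hpar).symm
      have : IsCoprime (h^2) 4 := by
        have := hc.pow (m := 2) (n := 2); norm_num at this; exact this
      have := hs h (by rw [← sq]; exact this.dvd_of_dvd_mul_left h4s)
      exact this.dvd
  have hMX : M ∣ h * X := by
    have hb : h = d * d.gcdA e + e * d.gcdB e := Int.gcd_eq_gcd_ab d e
    rw [hb, he, add_mul]
    apply dvd_add
    · rw [mul_assoc]; exact mul_dvd_mul_left d (heX.mul_left _)
    · rw [mul_assoc, mul_comm d e]; exact mul_dvd_mul_left e (hdX.mul_left _)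
  exact hMX.trans (mul_dvd_mul_right hh2 X)

theorem prim_count_s16 (s M : ℤ) (hs : Squarefree s) (hs0 : 0 < s) (hM : 0 < M) (T : Finset (ℤ × ℤ))
    (hT : ∀ x ∈ T, x.1^2 + s*x.2^2 = M ∧ IsCoprime x.1 x.2) :
    T.card ≤ 10 * M.natAbs.divisors.card := by
  rcases T.eq_empty_or_nonempty with rfl | ⟨⟨u1, v1⟩, hx1⟩
  · simp
  obtain ⟨h1, c1⟩ := hT _ hx1
  dsimp only at h1 c1
  refine Finset.card_le_mul_card_image_of_maps_to
    (f := fun x : ℤ × ℤ => M.gcd (u1*x.2-x.1*v1)) ?_ 10 ?_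
  · intro x hx
    simp only [Nat.mem_divisors]
    exact ⟨by simpa using Int.natAbs_dvd_natAbs.mpr (Int.gcd_dvd_left M (u1*x.2-x.1*v1)),
      by omega⟩
  intro d hd
  rcases (T.filter (fun x : ℤ × ℤ => M.gcd (u1*x.2-x.1*v1) = d)).eq_empty_or_nonempty with h | ⟨⟨u2,v2⟩, hx2⟩
  · rw [h]; simp
  obtain ⟨hx2, g2⟩ := Finset.mem_filter.mp hx2
  obtain ⟨h2, c2⟩ := hT _ hx2
  dsimp only at h2 c2 g2
  have hcard : ((Finset.Icc (-2:ℤ) 2) ×ˢ (Finset.univ : Finset Bool)).card = 10 := by decide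
  rw [← hcard]
  have hid : ∀ u v : ℤ, u^2+s*v^2 = M → (u2*u+s*v2*v)^2 + s*(u2*v-u*v2)^2 = M^2 := by
    intro u v h
    linear_combination (u^2 + s*v^2)*h2 + M*h
  apply Finset.card_le_card_of_injOn
    (fun x : ℤ × ℤ => ((2*(u2*x.2-x.1*v2))/M, decide (0 ≤ u2*x.1+s*v2*x.2)))
  · rintro ⟨u3, v3⟩ hx3
    obtain ⟨hx3, g3⟩ := Finset.mem_filter.mp (Finset.mem_coe.mp hx3)
    obtain ⟨h3, c3⟩ := hT _ hx3
    dsimp only at h3 c3 g3 ⊢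
    obtain ⟨k, hk⟩ := prim_core s M u1 v1 u2 v2 u3 v3 d hs hM h1 h2 h3 c1 c2 (by exact_mod_cast g2) (by exact_mod_cast g3)
    rw [hk, Int.mul_ediv_cancel_left _ hM.ne']
    have := hid _ _ h3
    have hX : (u2*v3-u3*v2)^2 ≤ M^2 := by nlinarith [sq_nonneg (u2*u3+s*v2*v3), sq_nonneg (u2*v3-u3*v2)]
    have hk2 : M^2*k^2 ≤ M^2*4 := by
      have h9 : M^2*k^2 = 4*(u2*v3-u3*v2)^2 := by rw [← mul_pow, ← hk]; ring
      linarith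
    have hk3 : k^2 ≤ 4 := le_of_mul_le_mul_left hk2 (by positivity)
    simp only [Finset.coe_product, Set.mem_prod, Finset.mem_coe, Finset.mem_Icc, Finset.mem_univ, and_true]
    constructor <;> nlinarith
  · rintro ⟨u3, v3⟩ hx3 ⟨u4, v4⟩ hx4 heq
    obtain ⟨hx3, g3⟩ := Finset.mem_filter.mp (Finset.mem_coe.mp hx3)
    obtain ⟨h3, c3⟩ := hT _ hx3
    obtain ⟨hx4, g4⟩ := Finset.mem_filter.mp (Finset.mem_coe.mp hx4)
    obtain ⟨h4, c4⟩ := hT _ hx4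
    dsimp only at h3 c3 g3 h4 c4 g4
    obtain ⟨k, hk⟩ := prim_core s M u1 v1 u2 v2 u3 v3 d hs hM h1 h2 h3 c1 c2 (by exact_mod_cast g2) (by exact_mod_cast g3)
    obtain ⟨l, hl⟩ := prim_core s M u1 v1 u2 v2 u4 v4 d hs hM h1 h2 h4 c1 c2 (by exact_mod_cast g2) (by exact_mod_cast g4)
    simp only [Prod.mk.injEq] at heq
    obtain ⟨heq1, heq2⟩ := heq
    rw [hk, hl, Int.mul_ediv_cancel_left _ hM.ne', Int.mul_ediv_cancel_left _ hM.ne'] at heq1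
    rw [heq1, ← hl] at hk
    have hX : u2*v3-u3*v2 = u2*v4-u4*v2 := by linarith
    have hY2 : (u2*u3+s*v2*v3)^2 = (u2*u4+s*v2*v4)^2 := by
      have a := hid _ _ h3
      have b := hid _ _ h4
      rw [hX] at a
      linarith
    have hY : u2*u3+s*v2*v3 = u2*u4+s*v2*v4 := by
      rw [decide_eq_decide] at heq2
      rcases sq_eq_sq_iff_eq_or_eq_neg.mp hY2 with h | h
      · exact h
      · rw [h] at heq2 ⊢
        by_cases h0 : 0 ≤ u2*u4+s*v2*v4
        · have := heq2.mpr h0; omega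
        · have : ¬ (0 ≤ -(u2*u4+s*v2*v4)) := fun h => h0 (heq2.mp h)
          omega
    have hu : M*u3 = M*u4 := by
      rw [← h2]
      linear_combination u2*hY - s*v2*hX
    have hv : M*v3 = M*v4 := by
      rw [← h2]
      linear_combination v2*hY + u2*hX
    rw [mul_left_cancel₀ hM.ne' hu, mul_left_cancel₀ hM.ne' hv]

theorem sqf_count (s M : ℤ) (hs : Squarefree s) (hs0 : 0 < s) (hM : 0 < M) (T : Finset (ℤ × ℤ))
    (hT : ∀ x ∈ T, x.1^2 + s*x.2^2 = M) :
    T.card ≤ (10 * M.natAbs.divisors.card) * M.natAbs.divisors.card := by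
  have hMn : M.natAbs ≠ 0 := by omega
  have hg2 : ∀ x ∈ T, ((Int.gcd x.1 x.2 : ℕ) : ℤ)^2 ∣ M := by
    intro x hx
    rw [← hT x hx]
    exact dvd_add (pow_dvd_pow_of_dvd (Int.gcd_dvd_left ..) 2)
      ((pow_dvd_pow_of_dvd (Int.gcd_dvd_right ..) 2).mul_left _)
  refine Finset.card_le_mul_card_image_of_maps_to
    (f := fun x : ℤ × ℤ => Int.gcd x.1 x.2) ?_ _ ?_
  · intro x hx
    rw [Nat.mem_divisors]
    refine ⟨?_, hMn⟩
    have := (Dvd.intro_left _ (by rw [sq]) : ((Int.gcd x.1 x.2 : ℕ) : ℤ) ∣ ((Int.gcd x.1 x.2 : ℕ) : ℤ)^2).trans (hg2 x hx)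
    exact Int.natCast_dvd.mp this
  intro g hg
  rcases (T.filter (fun x : ℤ × ℤ => Int.gcd x.1 x.2 = g)).eq_empty_or_nonempty with h | ⟨x0, hx0⟩
  · rw [h]; simp
  obtain ⟨hx0, g0⟩ := Finset.mem_filter.mp hx0
  obtain ⟨N, hN⟩ := hg2 x0 hx0
  rw [g0] at hN
  have hgp : 0 < g := Nat.pos_of_mem_divisors hg
  have hgz : (0:ℤ) < g := by exact_mod_cast hgp
  have hNp : 0 < N := by
    by_contra h
    have : (g:ℤ)^2 * N ≤ 0 := mul_nonpos_of_nonneg_of_nonpos (by positivity) (by omega)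
    omega
  have hdiv : N.natAbs.divisors.card ≤ M.natAbs.divisors.card := by
    apply Finset.card_le_card
    apply Nat.divisors_subset_of_dvd hMn
    exact Int.natAbs_dvd_natAbs.mpr ⟨(g:ℤ)^2, by rw [hN]; ring⟩
  refine le_trans ?_ (Nat.mul_le_mul_left 10 hdiv)
  rw [← Finset.card_image_of_injOn (f := fun x : ℤ × ℤ => (x.1 / g, x.2 / g))]
  · apply prim_count_s16 s N hs hs0 hNp
    intro y hy
    obtain ⟨x, hx, rfl⟩ := Finset.mem_image.mp hy
    obtain ⟨hx, gx⟩ := Finset.mem_filter.mp hx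
    dsimp only
    have e1 : x.1 / g * g = x.1 := Int.ediv_mul_cancel (gx ▸ Int.gcd_dvd_left ..)
    have e2 : x.2 / g * g = x.2 := Int.ediv_mul_cancel (gx ▸ Int.gcd_dvd_right ..)
    constructor
    · have := hT x hx
      rw [← e1, ← e2, hN] at this
      have h5 : (g:ℤ)^2 * ((x.1 / g)^2 + s*(x.2/g)^2) = (g:ℤ)^2 * N := by linarith
      exact mul_left_cancel₀ (by positivity) h5
    · rw [Int.isCoprime_iff_gcd_eq_one]
      have := Int.gcd_div_gcd_div_gcd (i := x.1) (j := x.2) (by omega)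
      rwa [gx] at this
  · intro x hx y hy hxy
    obtain ⟨hx, gx⟩ := Finset.mem_filter.mp (Finset.mem_coe.mp hx)
    obtain ⟨hy, gy⟩ := Finset.mem_filter.mp (Finset.mem_coe.mp hy)
    simp only [Prod.mk.injEq] at hxy
    have e1 : x.1 / g * g = x.1 := Int.ediv_mul_cancel (gx ▸ Int.gcd_dvd_left ..)
    have e2 : x.2 / g * g = x.2 := Int.ediv_mul_cancel (gx ▸ Int.gcd_dvd_right ..)
    have e3 : y.1 / g * g = y.1 := Int.ediv_mul_cancel (gy ▸ Int.gcd_dvd_left ..)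
    have e4 : y.2 / g * g = y.2 := Int.ediv_mul_cancel (gy ▸ Int.gcd_dvd_right ..)
    apply Prod.ext
    · rw [← e1, ← e3, hxy.1]
    · rw [← e2, ← e4, hxy.2]

theorem form_count (D M : ℤ) (hD : 0 < D) (T : Finset (ℤ × ℤ))
    (hT : ∀ x ∈ T, x.1^2 + D*x.2^2 = M) :
    T.card ≤ (10 * M.natAbs.divisors.card) * M.natAbs.divisors.card + 1 := by
  rcases lt_trichotomy M 0 with hM | hM | hM
  · have : T = ∅ := by
      apply Finset.eq_empty_of_forall_notMem
      intro x hx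
      have := hT x hx
      have : 0 ≤ x.1^2 + D*x.2^2 := by positivity
      omega
    simp [this]
  · have : T.card ≤ 1 := by
      rw [Finset.card_le_one]
      have : ∀ x ∈ T, x = (0,0) := by
        intro x hx
        have h := hT x hx
        have a : 0 ≤ x.1^2 := by positivity
        have b : 0 ≤ D*x.2^2 := by positivity
        have a0 : x.1^2 = 0 := by omega
        have b0 : D*x.2^2 = 0 := by omega
        have : x.2^2 = 0 := by
          rcases mul_eq_zero.mp b0 with h | h
          · omega
          · exact h
        exact Prod.ext (pow_eq_zero_iff (by norm_num) |>.mp a0) (pow_eq_zero_iff (by norm_num) |>.mp this)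
      intro x hx y hy; rw [this x hx, this y hy]
    omega
  · obtain ⟨s, f, hsf, hs⟩ := Nat.sq_mul_squarefree D.natAbs
    have hDz : (f:ℤ)^2 * s = D := by
      have : ((f^2*s : ℕ):ℤ) = (D.natAbs : ℤ) := by exact_mod_cast hsf
      rw [Int.natAbs_of_nonneg hD.le] at this
      exact_mod_cast this
    have hf : (f:ℤ) ≠ 0 := by intro h; rw [h] at hDz; simp at hDz; omega
    have hs0 : s ≠ 0 := hs.ne_zero
    have := sqf_count s M (Int.squarefree_natCast.mpr hs) (by omega) hM
      (T.image (fun x => (x.1, f*x.2))) (by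
        intro y hy
        obtain ⟨x, hx, rfl⟩ := Finset.mem_image.mp hy
        dsimp only
        rw [← hT x hx, ← hDz]; ring)
    rw [Finset.card_image_of_injOn] at this
    · omega
    · intro x _ y _ hxy
      simp only [Prod.mk.injEq] at hxy
      exact Prod.ext hxy.1 (mul_left_cancel₀ hf hxy.2)

theorem form_bound (ε : ℝ) (hε : 0 < ε) : ∃ C : ℝ, 0 < C ∧ ∀ (R : ℝ), 1 ≤ R → ∀ (D M : ℤ), 0 < D →
    (M:ℝ) ≤ R → ∀ T : Finset (ℤ × ℤ), (∀ x ∈ T, x.1^2 + D*x.2^2 = M) → (T.card : ℝ) ≤ C * R^ε := by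
  obtain ⟨C, hC, h⟩ := divisor_bound (ε/2) (by positivity)
  refine ⟨10*C^2+1, by positivity, ?_⟩
  intro R hR D M hD hMR T hT
  have h1 : (1:ℝ) ≤ R^ε := Real.one_le_rpow hR hε.le
  by_cases hM : 0 < M
  · have hc : (T.card : ℝ) ≤ (10 * M.natAbs.divisors.card) * M.natAbs.divisors.card + 1 := by
      exact_mod_cast form_count D M hD T hT
    have hd : (M.natAbs.divisors.card : ℝ) ≤ C * R^(ε/2) := by
      refine (h _ (by omega)).trans ?_
      have : ((M.natAbs : ℕ):ℝ) = (M:ℝ) := by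
        rw [Nat.cast_natAbs, abs_of_pos hM]
      rw [this]
      have : (0:ℝ) ≤ M := by exact_mod_cast hM.le
      gcongr
    have hR2 : R^ε = R^(ε/2) * R^(ε/2) := by
      rw [← Real.rpow_add (by positivity)]; ring_nf
    calc (T.card : ℝ) ≤ (10 * (C * R^(ε/2))) * (C * R^(ε/2)) + 1 := by
          refine hc.trans ?_
          gcongr
      _ = 10*C^2*R^ε + 1 := by rw [hR2]; ring
      _ ≤ _ := by linarith
  · have hc : T.card ≤ 1 := by
      rcases lt_or_eq_of_le (not_lt.mp hM) with h0 | h0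
      · have := form_count D M hD T hT
        have hT0 : T = ∅ := by
          apply Finset.eq_empty_of_forall_notMem
          intro x hx
          have := hT x hx
          have : 0 ≤ x.1^2 + D*x.2^2 := by positivity
          omega
        simp [hT0]
      · have := form_count D M hD T hT
        simpa [h0] using this
    have : (T.card:ℝ) ≤ 1 := by exact_mod_cast hc
    nlinarith [sq_nonneg C]

theorem plane_bound (ε : ℝ) (hε : 0 < ε) : ∃ C : ℝ, 0 < C ∧ ∀ (H : ℝ), 1 ≤ H →
    ∀ (a b c k n : ℤ), ¬ (a = 0 ∧ b = 0 ∧ c = 0) → |(a:ℝ)| ≤ H → |(b:ℝ)| ≤ H → |(c:ℝ)| ≤ H →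
    (n:ℝ) ≤ H → ∀ T : Finset (Fin 3 → ℤ),
    (∀ x ∈ T, a * x 0 + b * x 1 + c * x 2 = k ∧ x 0 ^2 + x 1 ^2 + x 2 ^2 = n) →
    (T.card : ℝ) ≤ C * H^ε := by
  obtain ⟨C, hC, h⟩ := form_bound (ε/5) (by positivity)
  refine ⟨C * 6^(ε/5), by positivity, ?_⟩
  intro H hH a b c k n habc ha hb hc hn T hT
  have hR : C * 6^(ε/5) * H^ε = C * (6*H^5)^(ε/5) := by
    rw [Real.mul_rpow (by norm_num) (by positivity), ← Real.rpow_natCast H 5,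
      ← Real.rpow_mul (by positivity)]
    push_cast
    rw [mul_div_cancel₀ ε (by norm_num : (5:ℝ) ≠ 0)]
    ring
  rw [hR]
  have hH5 : 1 ≤ H^5 := one_le_pow₀ hH
  have hHH : H ≤ H^5 := le_self_pow₀ hH (by norm_num)
  have sqb : ∀ t : ℝ, |t| ≤ H → t^2 ≤ H^2 := by
    intro t ht; exact sq_le_sq' (by linarith [neg_abs_le t]) (by linarith [le_abs_self t])
  by_cases hab : a = 0 ∧ b = 0
  · obtain ⟨rfl, rfl⟩ := hab
    have hc0 : c ≠ 0 := by intro h; exact habc ⟨rfl, rfl, h⟩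
    rcases T.eq_empty_or_nonempty with rfl | ⟨x0, hx0⟩
    · simp; positivity
    have hz : ∀ x ∈ T, x 2 = x0 2 := by
      intro x hx
      have := (hT x hx).1
      have h2 := (hT x0 hx0).1
      apply mul_left_cancel₀ hc0
      linarith
    have := h (6*H^5) (by linarith) 1 (n - x0 2 ^2) (by norm_num) (by
      push_cast; nlinarith [sq_nonneg (x0 2 : ℝ)]) (T.image (fun x => (x 0, x 1))) (by
        intro y hy
        obtain ⟨x, hx, rfl⟩ := Finset.mem_image.mp hy
        dsimp only
        rw [← (hT x hx).2, hz x hx]; ring)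
    rwa [Finset.card_image_of_injOn] at this
    intro x hx y hy hxy
    simp only [Prod.mk.injEq] at hxy
    ext i
    fin_cases i
    · exact hxy.1
    · exact hxy.2
    · exact (hz x hx).trans (hz y hy).symm
  · have hq : 0 < a^2+b^2 := by
      by_contra hneg
      have ha2 := sq_nonneg a
      have hb2 := sq_nonneg b
      exact hab ⟨pow_eq_zero_iff (n := 2) (by norm_num) |>.mp (by omega),
        pow_eq_zero_iff (n := 2) (by norm_num) |>.mp (by omega)⟩
    have hD : 0 < a^2+b^2+c^2 := by positivity
    have hbound : (((a^2+b^2)*((a^2+b^2+c^2)*n - k^2) : ℤ) : ℝ) ≤ 6*H^5 := by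
      push_cast
      have h1 : (a:ℝ)^2+b^2 ≤ 2*H^2 := by linarith [sqb _ ha, sqb _ hb]
      have h2 : (a:ℝ)^2+b^2+c^2 ≤ 3*H^2 := by linarith [sqb _ ha, sqb _ hb, sqb _ hc]
      calc ((a:ℝ)^2+b^2)*(((a:ℝ)^2+b^2+c^2)*n - k^2) ≤ ((a:ℝ)^2+b^2)*(((a:ℝ)^2+b^2+c^2)*H) := by
            apply mul_le_mul_of_nonneg_left _ (by positivity)
            have : ((a:ℝ)^2+b^2+c^2)*n ≤ ((a:ℝ)^2+b^2+c^2)*H := by gcongr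
            nlinarith [sq_nonneg (k:ℝ)]
        _ ≤ (2*H^2)*((3*H^2)*H) := by gcongr
        _ = _ := by ring
    have := h (6*H^5) (by linarith) (a^2+b^2+c^2) _ hD hbound
      (T.image (fun x => (-(c*a)*x 0 - c*b*x 1 + (a^2+b^2)*x 2, a*x 1 - b*x 0))) (by
        intro y hy
        obtain ⟨x, hx, rfl⟩ := Finset.mem_image.mp hy
        dsimp only
        rw [← (hT x hx).2, ← (hT x hx).1]; ring)
    rwa [Finset.card_image_of_injOn] at this
    intro x hx y hy hxy
    simp only [Prod.mk.injEq] at hxy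
    obtain ⟨hU, hV⟩ := hxy
    have hK := (hT x hx).1.trans (hT y hy).1.symm
    have e2 : x 2 = y 2 := by
      have : (a^2+b^2+c^2) * x 2 = (a^2+b^2+c^2) * y 2 := by
        linear_combination hU + c*hK
      exact mul_left_cancel₀ hD.ne' this
    have e0 : x 0 = y 0 := by
      have : (a^2+b^2) * x 0 = (a^2+b^2) * y 0 := by
        linear_combination a*hK - b*hV - a*c*e2
      exact mul_left_cancel₀ hq.ne' this
    have e1 : x 1 = y 1 := by
      have : (a^2+b^2) * x 1 = (a^2+b^2) * y 1 := by
        linear_combination b*hK + a*hV - b*c*e2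
      exact mul_left_cancel₀ hq.ne' this
    ext i
    fin_cases i
    · exact e0
    · exact e1
    · exact e2

theorem det_bound (K : Set (Fin 3 → ℝ)) (hK : Convex ℝ K) (V₀ : ℝ) (hV : 0 < V₀)
    (hvol : volume K ≤ ENNReal.ofReal V₀) (A B C D : Fin 3 → ℝ)
    (hA : A ∈ K) (hB : B ∈ K) (hC : C ∈ K) (hD : D ∈ K) :
    |(Matrix.of ![B - A, C - A, D - A]).det| ≤ 27 * V₀ := by
  set M := Matrix.of ![B - A, C - A, D - A] with hM
  set S : Set (Fin 3 → ℝ) := Set.Icc (fun _ => 0) (fun _ => 1/3) with hS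
  have hSv : volume S = ENNReal.ofReal (1/27) := by
    rw [hS, Real.volume_Icc_pi, Fin.prod_univ_three, ← ENNReal.ofReal_mul (by norm_num),
      ← ENNReal.ofReal_mul (by norm_num)]
    norm_num
  have hsub : (fun y => A + y) '' ((Matrix.toLin' M.transpose) '' S) ⊆ K := by
    rintro _ ⟨_, ⟨y, hy, rfl⟩, rfl⟩
    have h0 : ∀ i, 0 ≤ y i := fun i => hy.1 i
    have h1 : ∀ i, y i ≤ 1/3 := fun i => hy.2 i
    have := hK.sum_mem (t := Finset.univ) (w := ![1 - y 0 - y 1 - y 2, y 0, y 1, y 2])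
      (z := ![A, B, C, D]) (by
        intro i _
        fin_cases i
        · have := h1 0; have := h1 1; have := h1 2
          simp; linarith
        · exact h0 0
        · exact h0 1
        · exact h0 2) (by simp [Fin.sum_univ_four]; ring) (by
        intro i _; fin_cases i <;> simp [*])
    convert this using 1
    ext i
    simp [Fin.sum_univ_four, hM, Matrix.mulVec, dotProduct, Fin.sum_univ_three]
    ring
  have hle := (measure_mono hsub).trans hvol
  rw [Set.image_add_left, measure_preimage_add, Measure.addHaar_image_linearMap, hSv,
    LinearMap.det_toLin', Matrix.det_transpose, ← ENNReal.ofReal_mul (abs_nonneg _),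
    ENNReal.ofReal_le_ofReal_iff hV.le] at hle
  linarith

theorem noncol (A B C : Fin 3 → ℤ) (n : ℤ)
    (hA : A 0 ^2 + A 1 ^2 + A 2 ^2 = n) (hB : B 0 ^2 + B 1 ^2 + B 2 ^2 = n)
    (hC : C 0 ^2 + C 1 ^2 + C 2 ^2 = n) (hAB : A ≠ B) (hAC : A ≠ C) (hBC : B ≠ C) :
    ¬ ((B 1 - A 1)*(C 2 - A 2) - (B 2 - A 2)*(C 1 - A 1) = 0 ∧
       (B 2 - A 2)*(C 0 - A 0) - (B 0 - A 0)*(C 2 - A 2) = 0 ∧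
       (B 0 - A 0)*(C 1 - A 1) - (B 1 - A 1)*(C 0 - A 0) = 0) := by
  rintro ⟨h0, h1, h2⟩
  have ne : ∀ X Y : Fin 3 → ℤ, X ≠ Y → 0 < (X 0 - Y 0)^2 + (X 1 - Y 1)^2 + (X 2 - Y 2)^2 := by
    intro X Y h
    by_contra hn
    have a := sq_nonneg (X 0 - Y 0)
    have b := sq_nonneg (X 1 - Y 1)
    have c := sq_nonneg (X 2 - Y 2)
    apply h
    ext i
    have key : ∀ t : ℤ, t^2 = 0 → t = 0 := fun t ht => pow_eq_zero_iff (by norm_num) |>.mp ht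
    fin_cases i
    · have := key (X 0 - Y 0) (by omega); simp; omega
    · have := key (X 1 - Y 1) (by omega); simp; omega
    · have := key (X 2 - Y 2) (by omega); simp; omega
  have nB := ne B A hAB.symm
  have nC := ne C A hAC.symm
  have nBC := ne B C hBC
  obtain ⟨p0, hp0⟩ : ∃ p, p = B 0 - A 0 := ⟨_, rfl⟩
  obtain ⟨p1, hp1⟩ : ∃ p, p = B 1 - A 1 := ⟨_, rfl⟩
  obtain ⟨p2, hp2⟩ : ∃ p, p = B 2 - A 2 := ⟨_, rfl⟩
  obtain ⟨q0, hq0⟩ : ∃ p, p = C 0 - A 0 := ⟨_, rfl⟩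
  obtain ⟨q1, hq1⟩ : ∃ p, p = C 1 - A 1 := ⟨_, rfl⟩
  obtain ⟨q2, hq2⟩ : ∃ p, p = C 2 - A 2 := ⟨_, rfl⟩
  have eB0 : B 0 = A 0 + p0 := by omega
  have eB1 : B 1 = A 1 + p1 := by omega
  have eB2 : B 2 = A 2 + p2 := by omega
  have eC0 : C 0 = A 0 + q0 := by omega
  have eC1 : C 1 = A 1 + q1 := by omega
  have eC2 : C 2 = A 2 + q2 := by omega
  rw [eB0, eB1, eB2] at hB nBC
  rw [eC0, eC1, eC2] at hC nBC
  simp only [← hp0, ← hp1, ← hp2] at nB h0 h1 h2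
  simp only [← hq0, ← hq1, ← hq2] at nC h0 h1 h2
  have hp : 2*(A 0*p0 + A 1*p1+A 2*p2) = -(p0^2+p1^2+p2^2) := by linarith
  have hq : 2*(A 0*q0 + A 1*q1+A 2*q2) = -(q0^2+q1^2+q2^2) := by linarith
  generalize A 0 = x at *
  generalize A 1 = y at *
  generalize A 2 = z at *
  have f1 : (q0^2+q1^2+q2^2) * (p0*q0+p1*q1+p2*q2) = (q0^2+q1^2+q2^2)*(p0^2+p1^2+p2^2) := by
    have i0 : p0*(q0^2+q1^2+q2^2) = q0*(p0*q0+p1*q1+p2*q2) := by linear_combination q1*h2 - q2*h1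
    have i1 : p1*(q0^2+q1^2+q2^2) = q1*(p0*q0+p1*q1+p2*q2) := by linear_combination q2*h0 - q0*h2
    have i2 : p2*(q0^2+q1^2+q2^2) = q2*(p0*q0+p1*q1+p2*q2) := by linear_combination q0*h1 - q1*h0
    linear_combination 2*x*i0+2*y*i1+2*z*i2 - (q0^2+q1^2+q2^2)*hp + (p0*q0+p1*q1+p2*q2)*hq
  have f2 : (p0^2+p1^2+p2^2) * (p0*q0+p1*q1+p2*q2) = (p0^2+p1^2+p2^2)*(q0^2+q1^2+q2^2) := by
    have i0 : q0*(p0^2+p1^2+p2^2) = p0*(p0*q0+p1*q1+p2*q2) := by linear_combination -p1*h2 + p2*h1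
    have i1 : q1*(p0^2+p1^2+p2^2) = p1*(p0*q0+p1*q1+p2*q2) := by linear_combination -p2*h0 + p0*h2
    have i2 : q2*(p0^2+p1^2+p2^2) = p2*(p0*q0+p1*q1+p2*q2) := by linear_combination -p0*h1 + p1*h0
    linear_combination 2*x*i0+2*y*i1+2*z*i2 - (p0^2+p1^2+p2^2)*hq + (p0*q0+p1*q1+p2*q2)*hp
  have g1 := mul_left_cancel₀ nC.ne' f1
  have g2 := mul_left_cancel₀ nB.ne' f2
  nlinarith

theorem stmt16 (ε V₀ : ℝ) (hε : 0 < ε) (hV : 0 < V₀) :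
    ∃ C : ℝ, 0 < C ∧
      ∀ (lam : ℝ), 1 < lam →
        ∀ (E : Set (Fin 3 → ℝ)),
          E ⊆ {x : Fin 3 → ℝ | (∑ i, (x i) ^ 2) = lam ^ 2} →
          volume (convexHull ℝ E) ≤ ENNReal.ofReal V₀ →
            (Set.ncard {n : Fin 3 → ℤ | (fun i => ((n i : ℝ))) ∈ E} : ℝ)
              ≤ C * lam ^ ε := by
  obtain ⟨C, hC, h⟩ := plane_bound (ε/2) (by positivity)
  set K : ℤ := ⌊27 * V₀⌋ with hKdef
  have hK0 : 0 ≤ K := Int.floor_nonneg.mpr (by positivity)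
  set N : ℕ := (Finset.Icc (-K) K).card with hN
  refine ⟨N * (C * 8^(ε/2)) + 2, by positivity, ?_⟩
  intro lam hlam E hE hvol
  have hl1 : (1:ℝ) ≤ lam^ε := Real.one_le_rpow hlam.le hε.le
  set Z : Set (Fin 3 → ℤ) := {n : Fin 3 → ℤ | (fun i => ((n i : ℝ))) ∈ E} with hZ
  by_cases hbig : Z.ncard ≤ 2
  · have : (Z.ncard : ℝ) ≤ 2 := by exact_mod_cast hbig
    have : 0 ≤ N * (C * 8^(ε/2)) * lam^ε := by positivity
    nlinarith
  have hfin : Z.Finite := Set.finite_of_ncard_pos (by omega)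
  have hsph : ∀ x ∈ Z, (x 0 : ℝ)^2 + (x 1 : ℝ)^2 + (x 2 : ℝ)^2 = lam^2 := by
    intro x hx
    have := hE hx
    simpa [Fin.sum_univ_three] using this
  obtain ⟨A, hA, B, hB, P, hP, hAB, hAP, hBP⟩ := (Set.two_lt_ncard hfin).mp (by omega : 2 < Z.ncard)
  obtain ⟨n, hn⟩ : ∃ n : ℤ, n = A 0 ^2 + A 1 ^2 + A 2 ^2 := ⟨_, rfl⟩
  have hnl : (n:ℝ) = lam^2 := by rw [hn]; push_cast; exact hsph A hA
  have hsphz : ∀ x ∈ Z, x 0 ^2 + x 1 ^2 + x 2 ^2 = n := by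
    intro x hx
    have := hsph x hx
    rw [← hnl] at this
    exact_mod_cast this
  have hco : ∀ x ∈ Z, ∀ i, |(x i : ℝ)| ≤ lam := by
    intro x hx i
    apply abs_le_of_sq_le_sq _ (by linarith)
    have := hsph x hx
    have a := sq_nonneg (x 0 : ℝ)
    have b := sq_nonneg (x 1 : ℝ)
    have c := sq_nonneg (x 2 : ℝ)
    fin_cases i <;> simp <;> linarith
  have hdiff : ∀ x ∈ Z, ∀ y ∈ Z, ∀ i, |(x i : ℝ) - y i| ≤ 2*lam := by
    intro x hx y hy i
    have := abs_sub (x i : ℝ) (y i)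
    linarith [hco x hx i, hco y hy i]
  have hcross : ∀ i j, |((B i : ℝ) - A i)*((P j : ℝ) - A j) - ((B j : ℝ) - A j)*((P i : ℝ) - A i)| ≤ 8*lam^2 := by
    intro i j
    refine (abs_sub _ _).trans ?_
    rw [abs_mul, abs_mul]
    have h1 := mul_le_mul (hdiff B hB A hA i) (hdiff P hP A hA j) (abs_nonneg _) (by linarith)
    have h2 := mul_le_mul (hdiff B hB A hA j) (hdiff P hP A hA i) (abs_nonneg _) (by linarith)
    nlinarith
  set a := (B 1 - A 1)*(P 2 - A 2) - (B 2 - A 2)*(P 1 - A 1) with ha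
  set b := (B 2 - A 2)*(P 0 - A 0) - (B 0 - A 0)*(P 2 - A 2) with hb
  set c := (B 0 - A 0)*(P 1 - A 1) - (B 1 - A 1)*(P 0 - A 0) with hc
  have hnz : ¬ (a = 0 ∧ b = 0 ∧ c = 0) :=
    noncol A B P n (hsphz A hA) (hsphz B hB) (hsphz P hP) hAB hAP hBP
  have hmaps : ∀ x ∈ hfin.toFinset, a*(x 0 - A 0) + b*(x 1 - A 1) + c*(x 2 - A 2) ∈ Finset.Icc (-K) K := by
    intro x hx
    have hx : x ∈ Z := by simpa using hx
    have hsub := subset_convexHull ℝ E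
    have := det_bound _ (convex_convexHull ℝ E) V₀ hV hvol _ _ _ _ (hsub hA) (hsub hB) (hsub hP) (hsub hx)
    have hdet : (Matrix.of ![(fun i => (B i:ℝ)) - (fun i => (A i:ℝ)), (fun i => (P i:ℝ)) - (fun i => (A i:ℝ)), (fun i => (x i:ℝ)) - (fun i => (A i:ℝ))]).det
        = ((a*(x 0 - A 0) + b*(x 1 - A 1) + c*(x 2 - A 2) : ℤ) : ℝ) := by
      rw [Matrix.det_fin_three, ha, hb, hc]
      simp
      ring
    rw [hdet] at this
    rw [abs_le] at this
    rw [Finset.mem_Icc]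
    constructor
    · have : -(a*(x 0 - A 0) + b*(x 1 - A 1) + c*(x 2 - A 2)) ≤ K := by
        rw [hKdef, Int.le_floor]; rw [Int.cast_neg]; linarith
      omega
    · rw [hKdef, Int.le_floor]; exact this.2
  have hcard := Finset.card_eq_sum_card_fiberwise hmaps
  have hfib : ∀ k ∈ Finset.Icc (-K) K,
      (((hfin.toFinset.filter (fun x => a*(x 0 - A 0) + b*(x 1 - A 1) + c*(x 2 - A 2) = k)).card : ℕ) : ℝ)
        ≤ C * (8*lam^2)^(ε/2) := by
    intro k _
    apply h (8*lam^2) (by nlinarith) a b c (k + (a*A 0+b*A 1+c*A 2)) n hnz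
    · rw [ha]; push_cast; exact hcross 1 2
    · rw [hb]; push_cast; exact hcross 2 0
    · rw [hc]; push_cast; exact hcross 0 1
    · rw [hnl]; nlinarith
    · intro x hx
      rw [Finset.mem_filter] at hx
      refine ⟨by linarith [hx.2], hsphz x (by simpa using hx.1)⟩
  have hpow : (8*lam^2)^(ε/2) = 8^(ε/2) * lam^ε := by
    rw [Real.mul_rpow (by norm_num) (by positivity), ← Real.rpow_natCast lam 2,
      ← Real.rpow_mul (by positivity)]
    push_cast
    rw [mul_div_cancel₀ ε (by norm_num : (2:ℝ) ≠ 0)]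
  rw [Set.ncard_eq_toFinset_card Z hfin, hcard]
  push_cast
  calc _ ≤ ∑ k ∈ Finset.Icc (-K) K, C * (8*lam^2)^(ε/2) := Finset.sum_le_sum hfib
    _ = N * (C * 8^(ε/2)) * lam^ε := by
      rw [Finset.sum_const, nsmul_eq_mul, hpow, ← hN]; ring
    _ ≤ _ := by nlinarith
end

section
/- For every ε > 0 there exists a constant C = C(ε) such that for every λ > 1, every nonzero vector u ∈ ℝ³, and every x₀ ∈ ℝ³, the number of lattice points in the unit band B(u,x₀), i.e. the cardinality of {n ∈ ℤ³ : |n| = λ, |u·(n−x₀)| ≤ |u|}, is at most C·λ^{2/3+ε}. In other words, A_{1,3,λ} ≲ λ^{2/3+ε}. -/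
lemma aux_divisor_bound (δ : ℝ) (hδ : 0 < δ) :
    ∃ C : ℝ, 1 ≤ C ∧ ∀ n : ℕ, n ≠ 0 → (n.divisors.card : ℝ) ≤ C * (n : ℝ) ^ δ := by
  have hl2 : 0 < Real.log 2 := Real.log_pos (by norm_num)
  set M : ℝ := 1 + 1 / (δ * Real.log 2) with hM
  have hM1 : 1 ≤ M := by
    have : 0 < 1 / (δ * Real.log 2) := by positivity
    linarith
  set P : ℕ := ⌈(2 : ℝ) ^ (1 / δ)⌉₊ with hP
  refine ⟨M ^ P, one_le_pow₀ hM1, fun n hn => ?_⟩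
  rw [Nat.card_divisors hn]
  have hn' : (n : ℝ) ^ δ = ∏ p ∈ n.primeFactors, ((p : ℝ) ^ (n.factorization p)) ^ δ := by
    conv_lhs => rw [← Nat.prod_factorization_pow_eq_self hn]
    rw [Finsupp.prod, Nat.support_factorization]
    push_cast
    rw [Real.finsetProd_rpow]
    intro i _
    positivity
  rw [hn']
  push_cast
  have key : ∀ p ∈ n.primeFactors, ((n.factorization p : ℝ) + 1) ≤
      (if p < P then M else 1) * ((p : ℝ) ^ (n.factorization p)) ^ δ := by
    intro p hp
    have hpp := Nat.prime_of_mem_primeFactors hp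
    have hp2 : (2 : ℝ) ≤ p := by exact_mod_cast hpp.two_le
    generalize n.factorization p = a
    have hcomm : ((p : ℝ) ^ a) ^ δ = ((p : ℝ) ^ δ) ^ a := by
      rw [← Real.rpow_natCast, ← Real.rpow_natCast, ← Real.rpow_mul (by positivity),
        ← Real.rpow_mul (by positivity), mul_comm]
    rw [hcomm]
    split_ifs with h
    · have h1 : (2 : ℝ) ^ δ ≤ (p : ℝ) ^ δ := Real.rpow_le_rpow (by norm_num) hp2 hδ.le
      have h2 : ((2 : ℝ) ^ δ) ^ a ≤ ((p : ℝ) ^ δ) ^ a := pow_le_pow_left₀ (by positivity) h1 a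
      have h3 : (a : ℝ) * (δ * Real.log 2) + 1 ≤ ((2 : ℝ) ^ δ) ^ a := by
        rw [Real.rpow_def_of_pos (by norm_num), ← Real.exp_nat_mul]
        have := Real.add_one_le_exp ((a : ℝ) * (Real.log 2 * δ))
        linarith
      have hx : 0 < δ * Real.log 2 := by positivity
      have h4 : M * (a * (δ * Real.log 2) + 1) = a * (δ * Real.log 2) + 1 + a + 1 / (δ * Real.log 2) := by
        rw [hM]; field_simp; ring
      have h5 : 0 ≤ (a : ℝ) * (δ * Real.log 2) := by positivity
      have h6 : 0 < 1 / (δ * Real.log 2) := by positivity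
      calc (a : ℝ) + 1 ≤ M * (a * (δ * Real.log 2) + 1) := by rw [h4]; linarith
        _ ≤ _ := by gcongr; linarith
    · have h0 : (2 : ℝ) ^ (1 / δ) ≤ p := by
        push Not at h
        exact (Nat.le_ceil _).trans (by exact_mod_cast h)
      have h1 : (2 : ℝ) ≤ (p : ℝ) ^ δ := by
        calc (2 : ℝ) = ((2 : ℝ) ^ (1 / δ)) ^ δ := by
              rw [← Real.rpow_mul (by norm_num), one_div_mul_cancel hδ.ne', Real.rpow_one]
          _ ≤ _ := Real.rpow_le_rpow (by positivity) h0 hδ.le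
      have h2 : (2 : ℝ) ^ a ≤ ((p : ℝ) ^ δ) ^ a := pow_le_pow_left₀ (by positivity) h1 a
      have h3 : (a : ℝ) + 1 ≤ 2 ^ a := by exact_mod_cast Nat.lt_two_pow_self (n := a)
      linarith
  calc ∏ p ∈ n.primeFactors, ((n.factorization p : ℝ) + 1)
      ≤ ∏ p ∈ n.primeFactors, ((if p < P then M else 1) * ((p : ℝ) ^ (n.factorization p)) ^ δ) :=
        Finset.prod_le_prod (fun _ _ => by positivity) key
    _ = (∏ p ∈ n.primeFactors, (if p < P then M else 1)) *
          ∏ p ∈ n.primeFactors, ((p : ℝ) ^ (n.factorization p)) ^ δ := Finset.prod_mul_distrib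
    _ ≤ _ := by
      gcongr
      · rw [← Finset.prod_filter, Finset.prod_const]
        apply pow_le_pow_right₀ hM1
        calc _ ≤ (Finset.range P).card := Finset.card_le_card (by
              intro p hp
              simp at hp ⊢
              exact hp.2)
          _ = P := by simp

lemma aux_dvd (x0 y0 x y x' y' g : ℤ) (h0 : IsCoprime x0 y0)
    (h1 : g ∣ x0 * y - x * y0) (h2 : g ∣ x0 * y' - x' * y0) : g ∣ x * y' - x' * y := by
  obtain ⟨s, t, hst⟩ := h0
  obtain ⟨p, hp⟩ := h1
  obtain ⟨r, hr⟩ := h2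
  refine ⟨s * (x * r - x' * p) + t * (y * r - y' * p), ?_⟩
  linear_combination (-(x * y' - x' * y)) * hst + (s * x + t * y) * hr - (s * x' + t * y') * hp

lemma aux_e (d : ℕ) (hd : Squarefree d) (N e x y : ℤ) (h : x ^ 2 + d * y ^ 2 = N)
    (hc : IsCoprime x y) (he : e * e ∣ N) : IsCoprime e x ∧ IsCoprime e y := by
  have hN0 : ∀ p : ℤ, Prime p → p ∣ e → p ∣ d → False := by
    intro p hp hpe hpd
    have h2 : p * p ∣ N := (mul_dvd_mul hpe hpe).trans he
    have hx : p ∣ x := by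
      have : p ∣ x ^ 2 := by
        have h3 : x ^ 2 = N - d * y ^ 2 := by linarith
        rw [h3]
        exact dvd_sub ((dvd_mul_right p p).trans h2) (hpd.mul_right _)
      exact hp.dvd_of_dvd_pow this
    have hy : ¬ p ∣ y := fun hy => hp.not_isUnit (hc.isUnit_of_dvd' hx hy)
    have h4 : p * p ∣ (d : ℤ) * y ^ 2 := by
      have h3 : (d : ℤ) * y ^ 2 = N - x * x := by linarith
      rw [h3]
      exact dvd_sub h2 (mul_dvd_mul hx hx)
    have h5 : IsCoprime (p * p) (y ^ 2) := by
      have : IsCoprime p y := (hp.irreducible.coprime_iff_not_dvd).2 hy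
      exact (this.mul_left this).pow_right
    have h6 : p * p ∣ (d : ℤ) := h5.dvd_of_dvd_mul_right h4
    exact hp.not_isUnit ((Int.squarefree_natCast.2 hd) p h6)
  have hmain : ∀ p : ℤ, Prime p → p ∣ e → ¬ p ∣ x := by
    intro p hp hpe hx
    have h2 : p ∣ N := (dvd_mul_of_dvd_left hpe e).trans he
    have h4 : p ∣ (d : ℤ) * y ^ 2 := by
      have h3 : (d : ℤ) * y ^ 2 = N - x ^ 2 := by linarith
      rw [h3]
      exact dvd_sub h2 (dvd_pow hx two_ne_zero)
    rcases hp.dvd_or_dvd h4 with h5 | h5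
    · exact hN0 p hp hpe h5
    · exact hp.not_isUnit (hc.isUnit_of_dvd' hx (hp.dvd_of_dvd_pow h5))
  have hmain2 : ∀ p : ℤ, Prime p → p ∣ e → ¬ p ∣ y := by
    intro p hp hpe hy
    have h2 : p ∣ N := (dvd_mul_of_dvd_left hpe e).trans he
    have h4 : p ∣ x ^ 2 := by
      have h3 : x ^ 2 = N - d * y ^ 2 := by linarith
      rw [h3]
      exact dvd_sub h2 ((dvd_pow hy two_ne_zero).mul_left _)
    exact hp.not_isUnit (hc.isUnit_of_dvd' (hp.dvd_of_dvd_pow h4) hy)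
  have gen : ∀ z : ℤ, (∀ p : ℤ, Prime p → p ∣ e → ¬ p ∣ z) → IsCoprime e z := by
    intro z hz
    rw [Int.isCoprime_iff_gcd_eq_one]
    by_contra hg
    obtain ⟨p, hp, hpg⟩ := Nat.exists_prime_and_dvd hg
    have : (p : ℤ) ∣ (Int.gcd e z : ℤ) := by exact_mod_cast hpg
    exact hz p (Nat.prime_iff_prime_int.1 hp) (this.trans (Int.gcd_dvd_left ..)) (this.trans (Int.gcd_dvd_right ..))
  exact ⟨gen x hmain, gen y hmain2⟩

lemma aux_fib (d : ℕ) (hd : Squarefree d) (N x0 y0 x y x' y' : ℤ) (hN : 0 < N)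
    (h0 : x0 ^ 2 + d * y0 ^ 2 = N) (h : x ^ 2 + d * y ^ 2 = N) (h' : x' ^ 2 + d * y' ^ 2 = N)
    (c0 : IsCoprime x0 y0) (c : IsCoprime x y)
    (hg : Int.gcd N (x0 * y - x * y0) = Int.gcd N (x0 * y' - x' * y0)) :
    N ∣ 2 * (x * y' - x' * y) := by
  have key : ∀ x y : ℤ, x ^ 2 + d * y ^ 2 = N → ∀ h : ℤ, N = Int.gcd N (x0 * y - x * y0) * h →
      h ∣ x0 * y + x * y0 := by
    intro x y hxy h hh
    have hgp : (Int.gcd N (x0 * y - x * y0) : ℤ) ≠ 0 := by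
      intro h0; rw [h0] at hh; simp at hh; omega
    have hco : IsCoprime h ((x0 * y - x * y0) / Int.gcd N (x0 * y - x * y0)) := by
      have h1 := Int.isCoprime_iff_gcd_eq_one.2 (Int.gcd_div_gcd_div_gcd (i := N) (j := x0 * y - x * y0)
        (by have := hgp; omega))
      have h2 : N / (Int.gcd N (x0 * y - x * y0) : ℤ) = h :=
        Int.ediv_eq_of_eq_mul_right hgp hh
      rwa [h2] at h1
    obtain ⟨t, ht⟩ : (Int.gcd N (x0 * y - x * y0) : ℤ) ∣ (x0 * y - x * y0) := Int.gcd_dvd_right ..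
    have ht2 : (x0 * y - x * y0) / Int.gcd N (x0 * y - x * y0) = t :=
      Int.ediv_eq_of_eq_mul_right hgp ht
    rw [ht2] at hco
    apply hco.dvd_of_dvd_mul_left
    refine ⟨y ^ 2 - y0 ^ 2, ?_⟩
    apply mul_left_cancel₀ hgp
    have e1 : (x0 * y - x * y0) * (x0 * y + x * y0) = N * (y ^ 2 - y0 ^ 2) := by
      linear_combination y ^ 2 * h0 - y0 ^ 2 * hxy
    rw [← mul_assoc, ← mul_assoc, ← ht, ← hh, e1]
  obtain ⟨h1, hh1⟩ : (Int.gcd N (x0 * y - x * y0) : ℤ) ∣ N := Int.gcd_dvd_left ..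
  have k1 := key x y h h1 hh1
  have k2 := key x' y' h' h1 (hg ▸ hh1)
  have d1 : (Int.gcd N (x0 * y - x * y0) : ℤ) ∣ (x0 * y - x * y0) := Int.gcd_dvd_right ..
  have d2 : (Int.gcd N (x0 * y - x * y0) : ℤ) ∣ (x0 * y' - x' * y0) := by
    rw [hg]; exact Int.gcd_dvd_right ..
  generalize (Int.gcd N (x0 * y - x * y0) : ℤ) = g at *
  have D1 : g ∣ x * y' - x' * y := aux_dvd _ _ _ _ _ _ _ c0 d1 d2
  have D2 : h1 ∣ x * y' - x' * y := by
    refine aux_dvd x0 (-y0) _ _ _ _ _ c0.neg_right ?_ ?_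
    · simpa using k1
    · simpa using k2
  have he : (Int.gcd g h1 : ℤ) ∣ 2 := by
    have e1 : (Int.gcd g h1 : ℤ) ∣ g := Int.gcd_dvd_left ..
    have e2 : (Int.gcd g h1 : ℤ) ∣ h1 := Int.gcd_dvd_right ..
    have ee : (Int.gcd g h1 : ℤ) * Int.gcd g h1 ∣ N := by
      rw [hh1]; exact mul_dvd_mul e1 e2
    have q1 := (aux_e d hd N _ x0 y0 h0 c0 ee).1
    have q2 := (aux_e d hd N _ x y h c ee).2
    have : (Int.gcd g h1 : ℤ) ∣ 2 * (x0 * y) := by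
      have := dvd_add (e1.trans d1) (e2.trans k1)
      have e : x0 * y - x * y0 + (x0 * y + x * y0) = 2 * (x0 * y) := by ring
      rwa [e] at this
    exact (q1.mul_right q2).dvd_of_dvd_mul_right this
  have hl : (Int.lcm g h1 : ℤ) ∣ x * y' - x' * y := Int.coe_lcm_dvd D1 D2
  have hN' : N ∣ (Int.gcd g h1 : ℤ) * Int.lcm g h1 := by
    have : ((Int.gcd g h1 * Int.lcm g h1 : ℕ) : ℤ) = ((g * h1).natAbs : ℕ) := by
      rw [Int.gcd_mul_lcm, Int.natAbs_mul]
    push_cast at this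
    rw [this, ← hh1]
    exact (dvd_abs _ _).2 dvd_rfl
  exact hN'.trans (mul_dvd_mul he hl)

lemma aux_prim (d : ℕ) (hd : Squarefree d) (N : ℕ) (hN : 0 < N) (T : Finset (ℤ × ℤ))
    (hT : ∀ p ∈ T, p.1 ^ 2 + d * p.2 ^ 2 = N ∧ IsCoprime p.1 p.2) :
    T.card ≤ 10 * N.divisors.card := by
  rcases T.eq_empty_or_nonempty with rfl | ⟨⟨x0, y0⟩, hp0⟩
  · simp
  obtain ⟨h0, c0⟩ := hT _ hp0
  have hNz : (0 : ℤ) < N := by exact_mod_cast hN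
  have hd0 : (0 : ℤ) < d := by
    have := hd.ne_zero
    omega
  refine Finset.card_le_mul_card_image_of_maps_to
    (f := fun p : ℤ × ℤ => Int.gcd N (x0 * p.2 - p.1 * y0)) ?_ 10 ?_
  · intro p _
    rw [Nat.mem_divisors]
    refine ⟨?_, hN.ne'⟩
    have : (Int.gcd N (x0 * p.2 - p.1 * y0) : ℤ) ∣ N := Int.gcd_dvd_left ..
    exact_mod_cast this
  · intro g _
    set F := T.filter (fun p : ℤ × ℤ => Int.gcd N (x0 * p.2 - p.1 * y0) = g) with hF
    rcases F.eq_empty_or_nonempty with h | ⟨⟨x, y⟩, hp⟩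
    · simp [h]
    rw [hF, Finset.mem_filter] at hp
    obtain ⟨hpT, hpg⟩ := hp
    obtain ⟨h, c⟩ := hT _ hpT
    simp only at h c hpg h0 c0
    have hcard : (Finset.Icc (-2 : ℤ) 2 ×ˢ (Finset.univ : Finset Bool)).card = 10 := by
      simp [Finset.card_product]
    rw [← hcard]
    have hk : ∀ p ∈ F, ∃ k : ℤ, 2 * (x * p.2 - p.1 * y) = N * k ∧ -2 ≤ k ∧ k ≤ 2 := by
      rintro ⟨x', y'⟩ hp'
      rw [hF, Finset.mem_filter] at hp'
      obtain ⟨hpT', hpg'⟩ := hp'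
      obtain ⟨h', c'⟩ := hT _ hpT'
      simp only at h' c' hpg' ⊢
      obtain ⟨k, hk⟩ := aux_fib d hd N x0 y0 x y x' y' hNz h0 h h' c0 c (hpg.trans hpg'.symm)
      have hid : (x * x' + d * y * y') ^ 2 + d * (x * y' - x' * y) ^ 2 = (N : ℤ) ^ 2 := by
        linear_combination (x' ^ 2 + d * y' ^ 2) * h + N * h'
      have hD : (x * y' - x' * y) ^ 2 ≤ (N : ℤ) ^ 2 := by
        nlinarith [sq_nonneg (x * x' + d * y * y'), sq_nonneg (x * y' - x' * y)]
      have hk2 : (N * k) ^ 2 ≤ (2 * (N : ℤ)) ^ 2 := by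
        rw [← hk]; nlinarith
      have := abs_le.1 (abs_le_of_sq_le_sq hk2 (by positivity))
      refine ⟨k, hk, ?_, ?_⟩ <;> nlinarith
    choose! K hK using hk
    refine Finset.card_le_card_of_injOn
      (fun p => (K p, decide (0 ≤ x * p.1 + d * y * p.2))) ?_ ?_
    · intro p hp
      have := hK p hp
      simp
      omega
    · rintro ⟨x1, y1⟩ hp1 ⟨x2, y2⟩ hp2 heq
      simp only [Prod.mk.injEq, decide_eq_decide] at heq
      have k1 := (hK _ hp1).1
      have k2 := (hK _ hp2).1
      rw [heq.1] at k1
      simp only at k1 k2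
      have hD : x * y1 - x1 * y = x * y2 - x2 * y := by linarith
      have f1 := (hT _ (Finset.mem_filter.1 hp1).1).1
      have f2 := (hT _ (Finset.mem_filter.1 hp2).1).1
      simp only at f1 f2
      have hid1 : (x * x1 + d * y * y1) ^ 2 + d * (x * y1 - x1 * y) ^ 2 = (N : ℤ) ^ 2 := by
        linear_combination (x1 ^ 2 + d * y1 ^ 2) * h + N * f1
      have hid2 : (x * x2 + d * y * y2) ^ 2 + d * (x * y2 - x2 * y) ^ 2 = (N : ℤ) ^ 2 := by
        linear_combination (x2 ^ 2 + d * y2 ^ 2) * h + N * f2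
      have hE2 : (x * x1 + d * y * y1) ^ 2 = (x * x2 + d * y * y2) ^ 2 := by
        rw [hD] at hid1; linarith
      have hE : x * x1 + d * y * y1 = x * x2 + d * y * y2 := by
        have hs := heq.2
        rcases sq_eq_sq_iff_eq_or_eq_neg.1 hE2 with h | h
        · exact h
        · by_cases hh : 0 ≤ x * x1 + d * y * y1
          · have := hs.1 hh; omega
          · have := mt hs.2 hh; omega
      have e1 : (N : ℤ) * x1 = N * x2 := by
        linear_combination (x2 - x1) * h + x * hE - d * y * hD
      have e2 : (N : ℤ) * y1 = N * y2 := by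
        linear_combination (y2 - y1) * h + y * hE + x * hD
      simp only [Prod.mk.injEq]
      exact ⟨mul_left_cancel₀ hNz.ne' e1, mul_left_cancel₀ hNz.ne' e2⟩

lemma aux_all (d : ℕ) (hd : Squarefree d) (N : ℕ) (hN : 0 < N) (T : Finset (ℤ × ℤ))
    (hT : ∀ p ∈ T, p.1 ^ 2 + d * p.2 ^ 2 = N) :
    T.card ≤ 10 * N.divisors.card * N.divisors.card := by
  have hsq : ∀ p ∈ T, (Int.gcd p.1 p.2) ^ 2 ∣ N := by
    intro p hp
    have h := hT p hp
    have h1 : (Int.gcd p.1 p.2 : ℤ) ∣ p.1 := Int.gcd_dvd_left ..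
    have h2 : (Int.gcd p.1 p.2 : ℤ) ∣ p.2 := Int.gcd_dvd_right ..
    have : ((Int.gcd p.1 p.2 : ℤ)) ^ 2 ∣ N := by
      rw [← h]
      exact dvd_add (pow_dvd_pow_of_dvd h1 2) ((pow_dvd_pow_of_dvd h2 2).mul_left _)
    exact_mod_cast this
  refine Finset.card_le_mul_card_image_of_maps_to
    (f := fun p : ℤ × ℤ => Int.gcd p.1 p.2) ?_ _ ?_
  · intro p hp
    rw [Nat.mem_divisors]
    exact ⟨(dvd_pow_self _ two_ne_zero).trans (hsq p hp), hN.ne'⟩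
  · intro g hg
    have hg0 : 0 < g := Nat.pos_of_mem_divisors hg
    set F := T.filter (fun p : ℤ × ℤ => Int.gcd p.1 p.2 = g) with hF
    rcases F.eq_empty_or_nonempty with h | ⟨p0, hp0⟩
    · simp [h]
    have hgN : g ^ 2 ∣ N := by
      have := Finset.mem_filter.1 hp0
      rw [← this.2]; exact hsq _ this.1
    obtain ⟨N', hN'⟩ := hgN
    have hN'0 : 0 < N' := by
      rcases Nat.eq_zero_or_pos N' with h | h
      · rw [h] at hN'; omega
      · exact h
    have hgz : (g : ℤ) ≠ 0 := by exact_mod_cast hg0.ne'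
    have hdiv : ∀ p ∈ F, p.1 = g * (p.1 / g) ∧ p.2 = g * (p.2 / g) ∧
        IsCoprime (p.1 / (g : ℤ)) (p.2 / (g : ℤ)) := by
      intro p hp
      have hp2 := (Finset.mem_filter.1 hp).2
      have h1 : (Int.gcd p.1 p.2 : ℤ) ∣ p.1 := Int.gcd_dvd_left ..
      have h2 : (Int.gcd p.1 p.2 : ℤ) ∣ p.2 := Int.gcd_dvd_right ..
      have h3 := Int.isCoprime_iff_gcd_eq_one.2 (Int.gcd_div_gcd_div_gcd (i := p.1) (j := p.2)
        (by omega))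
      rw [hp2] at h1 h2 h3
      exact ⟨(Int.mul_ediv_cancel' h1).symm, (Int.mul_ediv_cancel' h2).symm, h3⟩
    have hinj : Set.InjOn (fun p : ℤ × ℤ => (p.1 / (g : ℤ), p.2 / (g : ℤ))) F := by
      intro p hp q hq h
      simp only [Prod.mk.injEq] at h
      obtain ⟨a1, a2, _⟩ := hdiv p hp
      obtain ⟨b1, b2, _⟩ := hdiv q hq
      ext
      · rw [a1, b1, h.1]
      · rw [a2, b2, h.2]
    rw [← Finset.card_image_of_injOn hinj]
    refine (aux_prim d hd N' hN'0 _ ?_).trans ?_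
    · intro p hp
      obtain ⟨q, hq, rfl⟩ := Finset.mem_image.1 hp
      obtain ⟨a1, a2, a3⟩ := hdiv q hq
      refine ⟨?_, a3⟩
      have h := hT q (Finset.mem_filter.1 hq).1
      rw [a1, a2, hN'] at h
      push_cast at h
      apply mul_left_cancel₀ (pow_ne_zero 2 hgz)
      simp only
      linear_combination h
    · exact Nat.mul_le_mul_left _ (Finset.card_le_card
        (Nat.divisors_subset_of_dvd hN.ne' ⟨g ^ 2, by rw [hN']; ring⟩))

lemma aux_gen (d : ℕ) (hd : 0 < d) (N : ℕ) (hN : 0 < N) (T : Finset (ℤ × ℤ))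
    (hT : ∀ p ∈ T, p.1 ^ 2 + d * p.2 ^ 2 = N) :
    T.card ≤ 10 * N.divisors.card * N.divisors.card := by
  obtain ⟨a, b, hab, ha⟩ := Nat.sq_mul_squarefree d
  have hb : (b : ℤ) ≠ 0 := by
    rintro h
    have : b = 0 := by exact_mod_cast h
    rw [this] at hab; simp at hab; omega
  have hinj : Set.InjOn (fun p : ℤ × ℤ => (p.1, (b : ℤ) * p.2)) T := by
    rintro ⟨x, y⟩ _ ⟨x', y'⟩ _ h
    simp only [Prod.mk.injEq] at h
    simp only [Prod.mk.injEq]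
    exact ⟨h.1, mul_left_cancel₀ hb h.2⟩
  rw [← Finset.card_image_of_injOn hinj]
  apply aux_all a ha N hN
  intro p hp
  obtain ⟨q, hq, rfl⟩ := Finset.mem_image.1 hp
  rw [← hT q hq, ← hab]
  push_cast
  ring

lemma aux_circle (ε : ℝ) (hε : 0 < ε) :
    ∃ C : ℝ, 0 < C ∧ ∀ (L : ℝ), 1 ≤ L → ∀ a b q m k : ℤ, q ≠ 0 →
      |(a : ℝ)| ≤ 5 * L → |(b : ℝ)| ≤ 5 * L → |(q : ℝ)| ≤ 5 * L → (m : ℝ) ≤ L ^ 2 →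
      ∀ T : Finset (ℤ × ℤ × ℤ), (∀ n ∈ T, n.1 ^ 2 + n.2.1 ^ 2 + n.2.2 ^ 2 = m ∧
        a * n.1 + b * n.2.1 + q * n.2.2 = k) → (T.card : ℝ) ≤ C * L ^ ε := by
  obtain ⟨C0, hC0, hdiv⟩ := aux_divisor_bound (ε / 12) (by positivity)
  refine ⟨10 * (C0 * (3750 : ℝ) ^ (ε / 12)) ^ 2, by positivity, ?_⟩
  intro L hL a b q m k hq ha hb hq5 hm T hT
  rcases T.eq_empty_or_nonempty with rfl | ⟨n0, hn0⟩
  · simp; positivity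
  have hm0 : 0 ≤ m := by rw [← (hT n0 hn0).1]; positivity
  have hA : 0 < q ^ 2 + a ^ 2 := by positivity
  have hD : 0 < a ^ 2 + b ^ 2 + q ^ 2 := by positivity
  set A : ℤ := q ^ 2 + a ^ 2 with hAd
  set D : ℤ := a ^ 2 + b ^ 2 + q ^ 2 with hDd
  set N : ℤ := A * (D * m - k ^ 2) with hNd
  let f : ℤ × ℤ × ℤ → ℤ × ℤ := fun n =>
    (-a * b * n.1 + A * n.2.1 - b * q * n.2.2, q * n.1 - a * n.2.2)
  have hinj : Set.InjOn f T := by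
    rintro ⟨x, y, z⟩ h1 ⟨x', y', z'⟩ h2 h
    have e1 := (hT _ h1).2
    have e2 := (hT _ h2).2
    simp only [f, Prod.mk.injEq] at h e1 e2
    obtain ⟨hY, hX⟩ := h
    have hv : a * x + b * y + q * z = a * x' + b * y' + q * z' := e1.trans e2.symm
    have hne : A * D ≠ 0 := by positivity
    simp only [Prod.mk.injEq]
    refine ⟨mul_left_cancel₀ hne ?_, mul_left_cancel₀ hne ?_, mul_left_cancel₀ hne ?_⟩
    · rw [hAd] at hY ⊢; rw [hDd]
      linear_combination (q ^ 2 + a ^ 2) * a * hv + (a ^ 2 + b ^ 2 + q ^ 2) * q * hX - a * b * hY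
    · rw [hAd] at hY ⊢; rw [hDd]
      linear_combination (q ^ 2 + a ^ 2) * b * hv + (q ^ 2 + a ^ 2) * hY
    · rw [hAd] at hY ⊢; rw [hDd]
      linear_combination (q ^ 2 + a ^ 2) * q * hv - (a ^ 2 + b ^ 2 + q ^ 2) * a * hX - b * q * hY
  have hrep : ∀ p ∈ T.image f, p.1 ^ 2 + D * p.2 ^ 2 = N := by
    intro p hp
    obtain ⟨⟨x, y, z⟩, hn, rfl⟩ := Finset.mem_image.1 hp
    obtain ⟨e1, e2⟩ := hT _ hn
    simp only [f] at e1 e2 ⊢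
    rw [hNd, ← e1, ← e2, hDd, hAd]
    ring
  have hcard : T.card = (T.image f).card := (Finset.card_image_of_injOn hinj).symm
  have hN0 : 0 ≤ N := by
    rw [← hrep _ (Finset.mem_image_of_mem f hn0)]; positivity
  have hLpow : 1 ≤ L ^ ε := Real.one_le_rpow hL hε.le
  have hNR : (N : ℝ) ≤ 3750 * L ^ 6 := by
    have ha2 : (a : ℝ) ^ 2 ≤ 25 * L ^ 2 := by
      have := sq_le_sq' (abs_le.1 ha).1 (abs_le.1 ha).2; linarith
    have hb2 : (b : ℝ) ^ 2 ≤ 25 * L ^ 2 := by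
      have := sq_le_sq' (abs_le.1 hb).1 (abs_le.1 hb).2; linarith
    have hq2 : (q : ℝ) ^ 2 ≤ 25 * L ^ 2 := by
      have := sq_le_sq' (abs_le.1 hq5).1 (abs_le.1 hq5).2; linarith
    have hAR : (A : ℝ) ≤ 50 * L ^ 2 := by rw [hAd]; push_cast; linarith
    have hDR : (D : ℝ) ≤ 75 * L ^ 2 := by rw [hDd]; push_cast; linarith
    have hmR : (0 : ℝ) ≤ m := by exact_mod_cast hm0
    have hA0 : (0 : ℝ) ≤ A := by exact_mod_cast hA.le
    have hD0 : (0 : ℝ) ≤ D := by exact_mod_cast hD.le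
    rw [hNd]
    push_cast
    calc (A : ℝ) * (D * m - k ^ 2) ≤ A * (D * m) := by
          apply mul_le_mul_of_nonneg_left _ hA0
          linarith [sq_nonneg (k : ℝ)]
      _ ≤ (50 * L ^ 2) * ((75 * L ^ 2) * L ^ 2) := by gcongr
      _ = _ := by ring
  have h3750 : (1 : ℝ) ≤ 3750 ^ (ε / 12) := Real.one_le_rpow (by norm_num) (by positivity)
  have hCC : 1 ≤ C0 * (3750 : ℝ) ^ (ε / 12) := one_le_mul_of_one_le_of_one_le hC0 h3750
  rcases hN0.eq_or_lt with hz | hpos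
  · have : T.card ≤ 1 := by
      rw [hcard, Finset.card_le_one]
      have : ∀ p ∈ T.image f, p = (0, 0) := by
        rintro ⟨x, y⟩ hp
        have := hrep _ hp
        rw [← hz] at this
        simp only at this
        have hx : x ^ 2 = 0 := by nlinarith [sq_nonneg x, mul_nonneg hD.le (sq_nonneg y)]
        have hy : y ^ 2 = 0 := by
          rw [hx, zero_add] at this
          exact (mul_eq_zero.1 this).resolve_left hD.ne'
        rw [pow_eq_zero_iff two_ne_zero] at hx hy
        rw [hx, hy]
      intro p hp p' hp'
      rw [this p hp, this p' hp']
    have h1 : (T.card : ℝ) ≤ 1 := by exact_mod_cast this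
    have h2 := one_le_mul_of_one_le_of_one_le (one_le_pow₀ hCC (n := 2)) hLpow
    nlinarith
  · obtain ⟨N', hN'⟩ := Int.eq_ofNat_of_zero_le hN0
    obtain ⟨D', hD'⟩ := Int.eq_ofNat_of_zero_le hD.le
    have h1 := aux_gen D' (by omega) N' (by omega) (T.image f) (by
      intro p hp
      have := hrep p hp
      rw [hN', hD'] at this
      exact this)
    rw [← hcard] at h1
    have h2 := hdiv N' (by omega)
    have h3 : (N' : ℝ) ≤ 3750 * L ^ 6 := by
      rw [hN'] at hNR; exact_mod_cast hNR
    have h4 : (N' : ℝ) ^ (ε / 12) ≤ 3750 ^ (ε / 12) * (L ^ 6) ^ (ε / 12) := by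
      rw [← Real.mul_rpow (by norm_num) (by positivity)]
      exact Real.rpow_le_rpow (by positivity) h3 (by positivity)
    have h5 : (N'.divisors.card : ℝ) ≤ C0 * (3750 ^ (ε / 12) * (L ^ 6) ^ (ε / 12)) :=
      h2.trans (by gcongr)
    have h6 : ((L ^ 6) ^ (ε / 12)) ^ 2 = L ^ ε := by
      rw [← Real.rpow_natCast, ← Real.rpow_natCast, ← Real.rpow_mul (by positivity),
        ← Real.rpow_mul (by positivity)]
      congr 1
      push_cast
      ring
    calc (T.card : ℝ) ≤ 10 * N'.divisors.card * N'.divisors.card := by exact_mod_cast h1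
      _ = 10 * (N'.divisors.card : ℝ) ^ 2 := by ring
      _ ≤ 10 * (C0 * (3750 ^ (ε / 12) * (L ^ 6) ^ (ε / 12))) ^ 2 := by gcongr
      _ = 10 * (C0 * 3750 ^ (ε / 12)) ^ 2 * ((L ^ 6) ^ (ε / 12)) ^ 2 := by ring
      _ = _ := by rw [h6]

lemma aux_dirichlet (α β : ℝ) (K : ℕ) (hK : 0 < K) :
    ∃ a b q : ℤ, 0 < q ∧ q ≤ (K : ℤ) ^ 2 ∧ |q * α - a| ≤ 1 / K ∧ |q * β - b| ≤ 1 / K := by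
  have hKR : (0 : ℝ) < K := by exact_mod_cast hK
  let f : ℕ → ℤ × ℤ := fun j => (⌊K * Int.fract (j * α)⌋, ⌊K * Int.fract (j * β)⌋)
  have hmaps : ∀ j ∈ Finset.range (K ^ 2 + 1),
      f j ∈ Finset.Ico (0 : ℤ) K ×ˢ Finset.Ico (0 : ℤ) K := by
    intro j _
    have gen : ∀ x : ℝ, ⌊K * Int.fract x⌋ ∈ Finset.Ico (0 : ℤ) K := by
      intro x
      rw [Finset.mem_Ico, Int.floor_nonneg, Int.floor_lt]
      have h1 := Int.fract_nonneg x
      have h2 := Int.fract_lt_one x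
      refine ⟨by positivity, ?_⟩
      push_cast
      nlinarith
    exact Finset.mem_product.2 ⟨gen _, gen _⟩
  obtain ⟨i, hi, j, hj, hij, hf⟩ := Finset.exists_ne_map_eq_of_card_lt_of_maps_to
    (by simp [Finset.card_product, sq]) hmaps
  have main : ∀ i j : ℕ, i < j → j < K ^ 2 + 1 → f i = f j →
    ∃ a b q : ℤ, 0 < q ∧ q ≤ (K : ℤ) ^ 2 ∧ |q * α - a| ≤ 1 / K ∧ |q * β - b| ≤ 1 / K := by
    intro i j hij hj hf
    have gen : ∀ x : ℝ, ⌊K * Int.fract (i * x)⌋ = ⌊K * Int.fract (j * x)⌋ →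
        |((j : ℤ) - (i : ℤ) : ℤ) * x - (⌊j * x⌋ - ⌊i * x⌋ : ℤ)| ≤ 1 / K := by
      intro x hx
      have h1 := Int.abs_sub_lt_one_of_floor_eq_floor hx
      rw [← mul_sub, abs_mul, abs_of_pos hKR] at h1
      have e : (((j : ℤ) - (i : ℤ) : ℤ) : ℝ) * x - (⌊j * x⌋ - ⌊i * x⌋ : ℤ) =
          -(Int.fract (i * x) - Int.fract (j * x)) := by
        unfold Int.fract; push_cast; ring
      rw [e, abs_neg, le_div_iff₀ hKR]
      linarith
    simp only [f, Prod.mk.injEq] at hf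
    refine ⟨_, _, (j : ℤ) - (i : ℤ), by omega, ?_, gen α hf.1, gen β hf.2⟩
    have : (j : ℤ) < (K : ℤ) ^ 2 + 1 := by exact_mod_cast hj
    omega
  rcases lt_or_gt_of_ne hij with h | h
  · exact main i j h (Finset.mem_range.1 hj) hf
  · exact main j i h (Finset.mem_range.1 hi) hf.symm

set_option maxHeartbeats 1000000 in
lemma aux_core (ε : ℝ) (hε : 0 < ε) :
    ∃ C : ℝ, 0 < C ∧ ∀ L : ℝ, 1 < L → ∀ α β c : ℝ, |α| ≤ 1 → |β| ≤ 1 →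
      ∀ T : Finset (ℤ × ℤ × ℤ), (∀ n ∈ T,
        (n.1 : ℝ) ^ 2 + (n.2.1 : ℝ) ^ 2 + (n.2.2 : ℝ) ^ 2 = L ^ 2 ∧
        |α * n.1 + β * n.2.1 + n.2.2 - c| ≤ 2) → (T.card : ℝ) ≤ C * L ^ ((2 : ℝ) / 3 + ε) := by
  obtain ⟨C0, hC0, hcirc⟩ := aux_circle ε hε
  refine ⟨21 * C0, by positivity, ?_⟩
  intro L hL α β c hα hβ T hT
  rcases T.eq_empty_or_nonempty with rfl | ⟨n0, hn0⟩
  · simp; positivity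
  set m : ℤ := n0.1 ^ 2 + n0.2.1 ^ 2 + n0.2.2 ^ 2 with hm
  have hmL : (m : ℝ) = L ^ 2 := by rw [← (hT n0 hn0).1, hm]; push_cast; ring
  have hL0 : 0 < L := by linarith
  set r : ℝ := L ^ ((1 : ℝ) / 3) with hr
  have hr1 : 1 ≤ r := Real.one_le_rpow hL.le (by norm_num)
  have hr3 : r ^ 3 = L := by
    rw [hr, ← Real.rpow_natCast, ← Real.rpow_mul hL0.le]; norm_num
  have hr2 : r ^ 2 = L ^ ((2 : ℝ) / 3) := by
    rw [hr, ← Real.rpow_natCast, ← Real.rpow_mul hL0.le]; norm_num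
  set K : ℕ := ⌈r⌉₊ with hK
  have hKr : r ≤ K := Nat.le_ceil r
  have hK2 : (K : ℝ) ≤ 2 * r := by
    have := Nat.ceil_lt_add_one (show 0 ≤ r by linarith); linarith
  have hKpos : 0 < K := Nat.ceil_pos.2 (by linarith)
  obtain ⟨a, b, q, hq0, hqK, haq, hbq⟩ := aux_dirichlet α β K hKpos
  have hqR0 : (0 : ℝ) < q := by exact_mod_cast hq0
  have hqR : (q : ℝ) ≤ 4 * r ^ 2 := by
    have h1 : (q : ℝ) ≤ (K : ℝ) ^ 2 := by exact_mod_cast hqK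
    nlinarith
  have hqL : (q : ℝ) ≤ 4 * L := by nlinarith [sq_nonneg r]
  have hKR : (1 : ℝ) ≤ K := by linarith
  have hinv : 1 / (K : ℝ) ≤ 1 / r := one_div_le_one_div_of_le (by linarith) hKr
  have hinv1 : 1 / r ≤ 1 := by rw [div_le_one (by linarith)]; exact hr1
  have hbd : ∀ (α : ℝ) (a : ℤ), |α| ≤ 1 → |q * α - a| ≤ 1 / K → |(a : ℝ)| ≤ 5 * L := by
    intro α a hα h
    rw [abs_le] at *
    constructor <;> nlinarith
  have ha5 := hbd α a hα haq
  have hb5 := hbd β b hβ hbq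
  have hq5 : |(q : ℝ)| ≤ 5 * L := by rw [abs_of_pos hqR0]; linarith
  let g : ℤ × ℤ × ℤ → ℤ := fun n => a * n.1 + b * n.2.1 + q * n.2.2
  set S : Finset ℤ := Finset.Icc ⌈q * c - 10 * r ^ 2⌉ ⌊q * c + 10 * r ^ 2⌋ with hS
  have hmaps : ∀ n ∈ T, g n ∈ S := by
    rintro ⟨x, y, z⟩ hn
    obtain ⟨h1, h2⟩ := hT _ hn
    simp only at h1 h2
    have hx : |(x : ℝ)| ≤ L := abs_le_of_sq_le_sq (by nlinarith [sq_nonneg (y : ℝ), sq_nonneg (z : ℝ)]) hL0.le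
    have hy : |(y : ℝ)| ≤ L := abs_le_of_sq_le_sq (by nlinarith [sq_nonneg (x : ℝ), sq_nonneg (z : ℝ)]) hL0.le
    have hLr : 1 / r * L = r ^ 2 := by rw [← hr3]; field_simp
    have e1 : |(q * α - a) * x| ≤ r ^ 2 := by
      rw [abs_mul, ← hLr]
      exact mul_le_mul (haq.trans hinv) hx (abs_nonneg _) (by positivity)
    have e2 : |(q * β - b) * y| ≤ r ^ 2 := by
      rw [abs_mul, ← hLr]
      exact mul_le_mul (hbq.trans hinv) hy (abs_nonneg _) (by positivity)
    have e3 : |q * (α * x + β * y + z - c)| ≤ 8 * r ^ 2 := by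
      rw [abs_mul, abs_of_pos hqR0]
      calc _ ≤ 4 * r ^ 2 * 2 := mul_le_mul hqR h2 (abs_nonneg _) (by positivity)
        _ = _ := by ring
    rw [abs_le] at e1 e2 e3
    rw [hS, Finset.mem_Icc, Int.ceil_le, Int.le_floor]
    simp only [g]
    push_cast
    constructor
    · linarith only [e1.2, e2.2, e3.1]
    · linarith only [e1.1, e2.1, e3.2]
  have hScard : (S.card : ℝ) ≤ 21 * r ^ 2 := by
    rw [hS, Int.card_Icc]
    have h1 := Int.floor_le (q * c + 10 * r ^ 2)
    have h2 := Int.le_ceil (q * c - 10 * r ^ 2)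
    have h3 : (((⌊q * c + 10 * r ^ 2⌋ + 1 - ⌈q * c - 10 * r ^ 2⌉).toNat : ℤ) : ℝ) ≤ 21 * r ^ 2 := by
      rw [Int.toNat_eq_max]
      push_cast
      apply max_le
      · nlinarith
      · positivity
    exact_mod_cast h3
  have hfib : ∀ k ∈ S, ((T.filter (fun n => g n = k)).card : ℝ) ≤ C0 * L ^ ε := by
    intro k _
    refine hcirc L hL.le a b q m k hq0.ne' ha5 hb5 hq5 hmL.le _ ?_
    intro n hn
    obtain ⟨h1, h2⟩ := Finset.mem_filter.1 hn
    refine ⟨?_, h2⟩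
    have := (hT n h1).1
    rw [← hmL] at this
    exact_mod_cast this
  rw [Finset.card_eq_sum_card_fiberwise hmaps]
  push_cast
  calc ∑ k ∈ S, ((T.filter (fun n => g n = k)).card : ℝ) ≤ ∑ k ∈ S, C0 * L ^ ε :=
        Finset.sum_le_sum hfib
    _ = S.card * (C0 * L ^ ε) := by rw [Finset.sum_const, nsmul_eq_mul]
    _ ≤ 21 * r ^ 2 * (C0 * L ^ ε) := by gcongr
    _ = _ := by rw [hr2, Real.rpow_add hL0]; ring

lemma aux_wrap (C E L : ℝ) (hL : 1 < L) (hC : 0 < C)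
    (hcore : ∀ α β c : ℝ, |α| ≤ 1 → |β| ≤ 1 →
      ∀ T : Finset (ℤ × ℤ × ℤ), (∀ n ∈ T,
        (n.1 : ℝ) ^ 2 + (n.2.1 : ℝ) ^ 2 + (n.2.2 : ℝ) ^ 2 = L ^ 2 ∧
        |α * n.1 + β * n.2.1 + n.2.2 - c| ≤ 2) → (T.card : ℝ) ≤ C * L ^ E)
    (u x₀ : Fin 3 → ℝ) (i j l : Fin 3) (hsum : ∀ f : Fin 3 → ℝ, ∑ t, f t = f i + f j + f l)
    (hall : ∀ t, t = i ∨ t = j ∨ t = l)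
    (hl : u l ≠ 0) (hi : |u i| ≤ |u l|) (hj : |u j| ≤ |u l|) :
    (Set.ncard {n : Fin 3 → ℤ |
              (∑ i, ((n i : ℝ)) ^ 2) = L ^ 2 ∧
              |∑ i, u i * ((n i : ℝ) - x₀ i)| ≤ Real.sqrt (∑ i, (u i) ^ 2)} : ℝ)
            ≤ C * L ^ E := by
  set S := {n : Fin 3 → ℤ | (∑ i, ((n i : ℝ)) ^ 2) = L ^ 2 ∧
              |∑ i, u i * ((n i : ℝ) - x₀ i)| ≤ Real.sqrt (∑ i, (u i) ^ 2)} with hS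
  rcases S.finite_or_infinite with hfin | hinf
  swap
  · rw [hinf.ncard]; simp; positivity
  rw [Set.ncard_eq_toFinset_card S hfin]
  let f : (Fin 3 → ℤ) → ℤ × ℤ × ℤ := fun n => (n i, n j, n l)
  have hinj : Function.Injective f := by
    intro n n' h
    simp only [f, Prod.mk.injEq] at h
    funext t
    rcases hall t with rfl | rfl | rfl
    · exact h.1
    · exact h.2.1
    · exact h.2.2
  rw [← Finset.card_image_of_injective _ hinj]
  have hlp : 0 < |u l| := abs_pos.2 hl
  refine hcore (u i / u l) (u j / u l) ((u i * x₀ i + u j * x₀ j + u l * x₀ l) / u l) ?_ ?_ _ ?_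
  · rw [abs_div, div_le_one hlp]; exact hi
  · rw [abs_div, div_le_one hlp]; exact hj
  intro p hp
  obtain ⟨n, hn, rfl⟩ := Finset.mem_image.1 hp
  rw [Set.Finite.mem_toFinset, hS] at hn
  obtain ⟨h1, h2⟩ := hn
  rw [hsum] at h1 h2
  rw [hsum] at h2
  refine ⟨h1, ?_⟩
  simp only [f]
  have e : u i / u l * (n i : ℝ) + u j / u l * (n j : ℝ) + n l -
      (u i * x₀ i + u j * x₀ j + u l * x₀ l) / u l =
      (u i * (n i - x₀ i) + u j * (n j - x₀ j) + u l * (n l - x₀ l)) / u l := by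
    field_simp; ring
  rw [e, abs_div, div_le_iff₀ hlp]
  refine h2.trans (Real.sqrt_le_iff.2 ⟨by positivity, ?_⟩)
  have a1 := sq_le_sq.2 hi
  have a2 := sq_le_sq.2 hj
  rw [mul_pow, sq_abs]
  nlinarith [sq_nonneg (u l)]

theorem stmt18 (ε : ℝ) (hε : 0 < ε) :
    ∃ C : ℝ, 0 < C ∧
      ∀ (lam : ℝ), 1 < lam →
        ∀ (u x₀ : Fin 3 → ℝ), u ≠ 0 →
          (Set.ncard {n : Fin 3 → ℤ |
              (∑ i, ((n i : ℝ)) ^ 2) = lam ^ 2 ∧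
              |∑ i, u i * ((n i : ℝ) - x₀ i)| ≤ Real.sqrt (∑ i, (u i) ^ 2)} : ℝ)
            ≤ C * lam ^ ((2 : ℝ) / 3 + ε) := by
  obtain ⟨C, hC, hcore⟩ := aux_core ε hε
  refine ⟨C, hC, fun lam hlam u x₀ hu => ?_⟩
  obtain ⟨l, hl⟩ := Finite.exists_max (fun t => |u t|)
  have hl0 : u l ≠ 0 := by
    intro h
    apply hu
    funext t
    have := hl t
    rw [h, abs_zero] at this
    exact abs_nonpos_iff.1 this
  have W := aux_wrap C _ lam hlam hC (hcore lam hlam) u x₀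
  fin_cases l
  · exact W 1 2 0 (fun f => by rw [Fin.sum_univ_three]; ring) (by decide) hl0 (hl _) (hl _)
  · exact W 0 2 1 (fun f => by rw [Fin.sum_univ_three]; ring) (by decide) hl0 (hl _) (hl _)
  · exact W 0 1 2 (fun f => by rw [Fin.sum_univ_three]) (by decide) hl0 (hl _) (hl _)
end
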